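/- arXiv:1103.5203 — 3 statements merged into one kernel-verified Lean document; each statement's English description precedes it below -/
import Mathlib

section
/- For every p ∈ (1,∞) and q ∈ [1,∞] there is a constant C_p > 0 such that for all measurable f, g : ℝⁿ → ℝ one has ‖f ∗ g‖_{L^∞(ℝⁿ)} ≤ C_p ‖f‖_{(p,q)} ‖g‖_{(p′,q′)}, where p′ and q′ are the Hölder conjugate exponents of p and q. -/
open MeasureTheory Real FourierTransform Metric Set Matrix
open scoped ENNReal Topology NNReal

noncomputable section

abbrev Eucl (n : ℕ) : Type := EuclideanSpace ℝ (Fin n)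

/-- The fractional Laplacian `Δ^{s/2}`: Fourier multiplier with symbol `(2π|ξ|)^s`. -/
noncomputable def fracLap {n : ℕ} (s : ℝ) (f : Eucl n → ℝ) : Eucl n → ℝ :=
  fun x => (𝓕⁻ (fun ξ : Eucl n =>
    (((2 * π * ‖ξ‖) ^ s : ℝ) : ℂ) * 𝓕 (fun y : Eucl n => (f y : ℂ)) ξ) x).re

/-- The normalizing constant of the Riesz potential `Δ^{-s/2}`. -/
noncomputable def rieszConst (n : ℕ) (s : ℝ) : ℝ :=
  Real.Gamma ((n - s) / 2) / (2 ^ s * π ^ ((n : ℝ) / 2) * Real.Gamma (s / 2))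

/-- The Riesz potential `Δ^{-s/2}`, convolution with `c_s |x|^{s-n}`. -/
noncomputable def rieszPot {n : ℕ} (s : ℝ) (f : Eucl n → ℝ) : Eucl n → ℝ :=
  fun x => rieszConst n s * ∫ y : Eucl n, ‖x - y‖ ^ (s - (n : ℝ)) * f y

/-- The three-commutator `H(a,b) = Δ^{n/4}(ab) - a Δ^{n/4} b - b Δ^{n/4} a`. -/
noncomputable def Hcomm {n : ℕ} (a b : Eucl n → ℝ) : Eucl n → ℝ :=
  fun x => fracLap ((n : ℝ) / 2) (fun y => a y * b y) x
    - a x * fracLap ((n : ℝ) / 2) b x - b x * fracLap ((n : ℝ) / 2) a x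

/-- The decreasing rearrangement of `f`. -/
noncomputable def decRear {n : ℕ} (f : Eucl n → ℝ) (t : ℝ) : ℝ≥0∞ :=
  ⨅ (s : ℝ≥0) (_ : volume {x : Eucl n | (s : ℝ) < |f x|} ≤ ENNReal.ofReal t), (s : ℝ≥0∞)

/-- The Lorentz quasinorm `‖f‖_{(p,q)}`. -/
noncomputable def lorentzNorm {n : ℕ} (p q : ℝ≥0∞) (f : Eucl n → ℝ) : ℝ≥0∞ :=
  if q = ∞ then
    (if p = ∞ then eLpNormEssSup f volume
     else ⨆ t : {t : ℝ // 0 < t}, ENNReal.ofReal (t.1 ^ (1 / p).toReal) * decRear f t.1)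
  else
    (∫⁻ t in Set.Ioi (0 : ℝ),
        (ENNReal.ofReal (t ^ (1 / p).toReal) * decRear f t) ^ q.toReal / ENNReal.ofReal t) ^
      (1 / q.toReal)

/-- The Lorentz quasinorm of `f` restricted to a set `A`. -/
noncomputable def lorentzNormOn {n : ℕ} (p q : ℝ≥0∞) (A : Set (Eucl n)) (f : Eucl n → ℝ) : ℝ≥0∞ :=
  lorentzNorm p q (A.indicator f)

/-- Smooth compactly supported test function with support in `D`. -/
def IsTestFn {n : ℕ} (D : Set (Eucl n)) (φ : Eucl n → ℝ) : Prop :=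
  ContDiff ℝ (⊤ : ℕ∞) φ ∧ HasCompactSupport φ ∧ tsupport φ ⊆ D

/-- A symbol of a zero-multiplier operator: smooth away from `0`, homogeneous of degree `0`. -/
def IsZeroSymbol {n : ℕ} (m : Eucl n → ℂ) : Prop :=
  ContDiffOn ℝ (⊤ : ℕ∞) m {0}ᶜ ∧ ∀ c : ℝ, 0 < c → ∀ x : Eucl n, m (c • x) = m x

/-- The zero-multiplier operator with symbol `m`. -/
noncomputable def zeroMultOp {n : ℕ} (m : Eucl n → ℂ) (f : Eucl n → ℝ) : Eucl n → ℝ :=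
  fun x => (𝓕⁻ (fun ξ : Eucl n => m ξ * 𝓕 (fun y : Eucl n => (f y : ℂ)) ξ) x).re

/-- A real kernel profile: smooth away from `0` and homogeneous of degree `0`
(equivalently, a smooth function of `x/|x|`). -/
def IsZeroHomogeneous {n : ℕ} (m : Eucl n → ℝ) : Prop :=
  ContDiffOn ℝ (⊤ : ℕ∞) m {0}ᶜ ∧ ∀ c : ℝ, 0 < c → ∀ x : Eucl n, m (c • x) = m x


/-- `D` is a smoothly bounded domain: the sublevel set of a smooth function with
nonvanishing gradient on the boundary. -/
def HasSmoothBoundary {n : ℕ} (D : Set (Eucl n)) : Prop :=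
  ∃ f : Eucl n → ℝ, ContDiff ℝ (⊤ : ℕ∞) f ∧ D = {x | f x < 0} ∧
    ∀ x ∈ frontier D, fderiv ℝ f x ≠ 0

lemma decRear_antitone {n : ℕ} (f : Eucl n → ℝ) : Antitone (decRear f) := by
  intro t u h
  unfold decRear
  refine iInf_mono fun s => ?_
  refine iInf_mono' fun hs => ⟨hs.trans (ENNReal.ofReal_le_ofReal h), le_rfl⟩

/-- distribution function -/
def dF {n : ℕ} (f : Eucl n → ℝ) (a : ℝ) : ℝ≥0∞ := volume {x : Eucl n | a < |f x|}

lemma dF_measurable {n : ℕ} (f : Eucl n → ℝ) : Measurable (dF f) := by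
  apply Antitone.measurable
  intro a b h
  exact measure_mono fun x hx => lt_of_le_of_lt h hx

lemma le_decRear {n : ℕ} (f : Eucl n → ℝ) (t a : ℝ) (h : ENNReal.ofReal t < dF f a) :
    ENNReal.ofReal a ≤ decRear f t := by
  unfold decRear
  refine le_iInf₂ fun s hs => ?_
  have : dF f s < dF f a := lt_of_le_of_lt hs h
  have h2 : a < s := by
    by_contra! hc
    exact absurd this (not_lt.mpr (measure_mono fun x hx => lt_of_le_of_lt hc hx))
  rw [← ENNReal.ofReal_coe_nnreal]
  exact ENNReal.ofReal_le_ofReal h2.le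

/-- indicator in `(t,a)`. -/
def iT {n : ℕ} (f : Eucl n → ℝ) (t a : ℝ) : ℝ≥0∞ :=
  {z : ℝ × ℝ | ENNReal.ofReal z.1 < dF f z.2}.indicator (fun _ => 1) (t, a)

def iX {n : ℕ} (f : Eucl n → ℝ) (x : Eucl n) (a : ℝ) : ℝ≥0∞ :=
  {z : Eucl n × ℝ | z.2 < |f z.1|}.indicator (fun _ => 1) (x, a)

lemma iT_meas {n : ℕ} (f : Eucl n → ℝ) : Measurable (fun z : ℝ × ℝ => iT f z.1 z.2) := by
  refine measurable_one.indicator (measurableSet_lt ?_ ?_)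
  · fun_prop
  · exact (dF_measurable f).comp measurable_snd

lemma iX_meas {n : ℕ} {f : Eucl n → ℝ} (hf : Measurable f) :
    Measurable (fun z : Eucl n × ℝ => iX f z.1 z.2) := by
  refine measurable_one.indicator (measurableSet_lt measurable_snd ?_)
  exact (continuous_abs.measurable.comp hf).comp measurable_fst

lemma iT_int {n : ℕ} (f : Eucl n → ℝ) (t : ℝ) :
    ∫⁻ a in Ioi (0:ℝ), iT f t a ≤ decRear f t := by
  by_cases htop : decRear f t = ∞
  · simp [htop]
  calc ∫⁻ a in Ioi (0:ℝ), iT f t a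
      ≤ ∫⁻ a in Ioi (0:ℝ), (Iic (decRear f t).toReal).indicator (fun _ => 1) a := by
        refine lintegral_mono fun a => ?_
        unfold iT
        by_cases h : ENNReal.ofReal t < dF f a
        · have h1 := le_decRear f t a h
          have h2 : a ≤ (decRear f t).toReal := (ENNReal.ofReal_le_iff_le_toReal htop).1 h1
          simp [indicator, h, h2]
        · simp [indicator, h]
    _ = decRear f t := by
        rw [lintegral_indicator measurableSet_Iic]
        simp [Measure.restrict_restrict, Iic_inter_Ioi, htop]

lemma iX_int {n : ℕ} (f : Eucl n → ℝ) (x : Eucl n) :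
    ∫⁻ a in Ioi (0:ℝ), iX f x a = ‖f x‖ₑ := by
  have : ∀ a, iX f x a = (Iio |f x|).indicator (fun _ => 1) a := by
    intro a; simp [iX, indicator]
  simp_rw [this]
  rw [lintegral_indicator measurableSet_Iio]
  simp [Measure.restrict_restrict, Iio_inter_Ioi, Real.enorm_eq_ofReal_abs]

lemma key_ab {n : ℕ} {f g : Eucl n → ℝ} (a b : ℝ) (hf : Measurable f) (hg : Measurable g) :
    ∫⁻ x, iX f x a * iX g x b ≤ ∫⁻ t in Ioi (0:ℝ), iT f t a * iT g t b := by
  have h1 : ∀ x, iX f x a * iX g x b =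
      ({x | a < |f x|} ∩ {x | b < |g x|}).indicator (fun _ => 1) x := by
    intro x
    by_cases h : a < |f x| <;> by_cases h' : b < |g x| <;> simp [iX, indicator, h, h']
  have h2 : ∀ t, iT f t a * iT g t b =
      {t | ENNReal.ofReal t < min (dF f a) (dF g b)}.indicator (fun _ => 1) t := by
    intro t
    by_cases h : ENNReal.ofReal t < dF f a <;> by_cases h' : ENNReal.ofReal t < dF g b <;>
      simp [iT, indicator, h, h']
  simp_rw [h1, h2]
  rw [lintegral_indicator, lintegral_indicator]
  · simp only [lintegral_const, one_mul, MeasurableSet.univ,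
      Measure.restrict_apply, univ_inter]
    rw [Measure.restrict_apply (measurableSet_lt (by fun_prop) (by fun_prop))]
    have h3 : volume ({x | a < |f x|} ∩ {x | b < |g x|}) ≤ min (dF f a) (dF g b) :=
      le_min (measure_mono inter_subset_left) (measure_mono inter_subset_right)
    refine h3.trans ?_
    generalize min (dF f a) (dF g b) = m
    by_cases hm : m = ∞
    · subst hm
      simp
    · have : Ioo 0 m.toReal ⊆ {t | ENNReal.ofReal t < m} ∩ Ioi 0 := by
        intro t ht
        exact ⟨(ENNReal.ofReal_lt_iff_lt_toReal ht.1.le hm).2 ht.2, ht.1⟩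
      refine le_trans ?_ (measure_mono this)
      simp [hm]
  · exact measurableSet_lt (by fun_prop) (by fun_prop)
  · exact (measurableSet_lt (by fun_prop) (by fun_prop)).inter
      (measurableSet_lt (by fun_prop) (by fun_prop))

/-- Product of two 1D integrals, swapped with outer integral. -/
lemma triple {α : Type*} [MeasurableSpace α] (μ : Measure α) [SFinite μ] (u v : α → ℝ → ℝ≥0∞)
    (hu : Measurable (fun z : α × ℝ => u z.1 z.2)) (hv : Measurable (fun z : α × ℝ => v z.1 z.2)) :
    ∫⁻ x, (∫⁻ a in Ioi (0:ℝ), u x a) * (∫⁻ b in Ioi (0:ℝ), v x b) ∂μ =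
      ∫⁻ a in Ioi (0:ℝ), ∫⁻ b in Ioi (0:ℝ), ∫⁻ x, u x a * v x b ∂μ := by
  have e1 : ∀ x, (∫⁻ a in Ioi (0:ℝ), u x a) * (∫⁻ b in Ioi (0:ℝ), v x b) =
      ∫⁻ z, u x z.1 * v x z.2
        ∂((volume.restrict (Ioi (0:ℝ))).prod (volume.restrict (Ioi (0:ℝ)))) := by
    intro x
    rw [lintegral_prod_mul]
    · exact (hu.comp (measurable_const.prodMk measurable_id)).aemeasurable
    · exact (hv.comp (measurable_const.prodMk measurable_id)).aemeasurable
  have hm : Measurable (fun w : α × (ℝ × ℝ) => u w.1 w.2.1 * v w.1 w.2.2) := by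
    apply Measurable.mul
    · exact hu.comp (measurable_fst.prodMk (measurable_fst.comp measurable_snd))
    · exact hv.comp (measurable_fst.prodMk (measurable_snd.comp measurable_snd))
  simp_rw [e1]
  rw [lintegral_lintegral_swap hm.aemeasurable, lintegral_prod]
  exact (Measurable.lintegral_prod_left' hm).aemeasurable

lemma hardyLittlewood {n : ℕ} {f g : Eucl n → ℝ} (hf : Measurable f) (hg : Measurable g) :
    ∫⁻ x, ‖f x‖ₑ * ‖g x‖ₑ ≤ ∫⁻ t in Ioi (0:ℝ), decRear f t * decRear g t := by
  calc ∫⁻ x, ‖f x‖ₑ * ‖g x‖ₑ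
      = ∫⁻ a in Ioi (0:ℝ), ∫⁻ b in Ioi (0:ℝ), ∫⁻ x, iX f x a * iX g x b := by
        rw [← triple _ _ _ (iX_meas hf) (iX_meas hg)]
        simp_rw [iX_int]
    _ ≤ ∫⁻ a in Ioi (0:ℝ), ∫⁻ b in Ioi (0:ℝ), ∫⁻ t in Ioi (0:ℝ), iT f t a * iT g t b :=
        lintegral_mono fun a => lintegral_mono fun b => key_ab a b hf hg
    _ = ∫⁻ t in Ioi (0:ℝ), (∫⁻ a in Ioi (0:ℝ), iT f t a) * (∫⁻ b in Ioi (0:ℝ), iT g t b) := by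
        rw [← triple _ _ _ (iT_meas f) (iT_meas g)]
    _ ≤ _ := lintegral_mono fun t => mul_le_mul' (iT_int f t) (iT_int g t)

lemma decRear_comp {n : ℕ} {g : Eucl n → ℝ} (hg : Measurable g) (x : Eucl n) :
    decRear (fun y => g (x - y)) = decRear g := by
  have : ∀ s : ℝ, volume {y : Eucl n | s < |g (x - y)|} = volume {y : Eucl n | s < |g y|} := by
    intro s
    have h := (Measure.measurePreserving_sub_left (volume : Measure (Eucl n)) x)
    exact h.measure_preimage
      (measurableSet_lt (by fun_prop) (by fun_prop) :
        MeasurableSet {y : Eucl n | s < |g y|}).nullMeasurableSet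
  funext t
  simp only [decRear, this]

lemma wt_meas {n : ℕ} (f : Eucl n → ℝ) (r : ℝ) :
    Measurable (fun t : ℝ => ENNReal.ofReal (t ^ r) * decRear f t) :=
  (by fun_prop : Measurable fun t : ℝ => ENNReal.ofReal (t ^ r)).mul
    (decRear_antitone f).measurable

lemma holder_one {A B : ℝ → ℝ≥0∞} (hB : Measurable B) (M : ℝ≥0∞)
    (hM : ∀ t, 0 < t → A t ≤ M) :
    ∫⁻ t in Ioi (0:ℝ), A t * B t / ENNReal.ofReal t ≤
      M * ∫⁻ t in Ioi (0:ℝ), B t / ENNReal.ofReal t := by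
  rw [← lintegral_const_mul M
    (by fun_prop : Measurable fun t : ℝ => B t / ENNReal.ofReal t)]
  refine setLIntegral_mono' measurableSet_Ioi fun t ht => ?_
  rw [mul_div_assoc]
  gcongr
  exact hM t ht

lemma holder_mid {A B : ℝ → ℝ≥0∞} (hA : Measurable A) (hB : Measurable B) {q q' : ℝ}
    (hq : q.HolderConjugate q') :
    ∫⁻ t in Ioi (0:ℝ), A t * B t / ENNReal.ofReal t ≤
      (∫⁻ t in Ioi (0:ℝ), A t ^ q / ENNReal.ofReal t) ^ (1 / q) *
      (∫⁻ t in Ioi (0:ℝ), B t ^ q' / ENNReal.ofReal t) ^ (1 / q') := by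
  have hq0 := hq.pos
  have hq0' := hq.symm.pos
  have e : ∀ t : ℝ, 0 < t → ∀ (r : ℝ), 0 < r → ∀ X : ℝ≥0∞,
      (X * ENNReal.ofReal t ^ (-(1/r))) ^ r = X ^ r / ENNReal.ofReal t := by
    intro t ht r hr X
    rw [ENNReal.mul_rpow_of_nonneg _ _ hr.le, ← ENNReal.rpow_mul, div_eq_mul_inv]
    congr 1
    rw [show -(1 * r⁻¹) * r = -1 by field_simp, ENNReal.rpow_neg_one]
  have h := ENNReal.lintegral_mul_le_Lp_mul_Lq (volume.restrict (Ioi (0:ℝ))) hq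
    (f := fun t => A t * ENNReal.ofReal t ^ (-(1/q)))
    (g := fun t => B t * ENNReal.ofReal t ^ (-(1/q')))
    (by fun_prop) (by fun_prop)
  rw [setLIntegral_congr_fun measurableSet_Ioi (fun t ht => e t ht q hq0 (A t)),
    setLIntegral_congr_fun measurableSet_Ioi (fun t ht => e t ht q' hq0' (B t))] at h
  refine le_trans (le_of_eq ?_) h
  refine setLIntegral_congr_fun measurableSet_Ioi fun t ht => ?_
  have ht' : ENNReal.ofReal t ≠ 0 := by simpa using ht
  have : ENNReal.ofReal t ^ (-(1/q)) * ENNReal.ofReal t ^ (-(1/q')) = (ENNReal.ofReal t)⁻¹ := by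
    rw [← ENNReal.rpow_add _ _ ht' ENNReal.ofReal_ne_top, ← ENNReal.rpow_neg_one]
    congr 1
    have := hq.inv_add_inv_eq_one
    simp only [one_div]
    linarith
  simp only [Pi.mul_apply]
  rw [mul_mul_mul_comm, this, div_eq_mul_inv]

lemma lorentz_holder {n : ℕ} {p p' q q' : ℝ≥0∞} (hp : 1 < p) (hptop : p < ⊤) (hq : 1 ≤ q)
    (hpc : 1 / p + 1 / p' = 1) (hqc : 1 / q + 1 / q' = 1) (f g : Eucl n → ℝ) :
    ∫⁻ t in Ioi (0:ℝ), decRear f t * decRear g t ≤ lorentzNorm p q f * lorentzNorm p' q' g := by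
  have hp'top : p' ≠ ∞ := by
    rintro rfl
    simp at hpc
    exact hp.ne' hpc
  have hp'0 : 1 / p' ≠ ∞ := by
    intro h; rw [h] at hpc; simp at hpc
  have hp0 : 1 / p ≠ ∞ := by
    intro h; rw [h] at hpc; simp at hpc
  have hr : (1 / p).toReal + (1 / p').toReal = 1 := by
    rw [← ENNReal.toReal_add hp0 hp'0, hpc]; rfl
  set r := (1 / p).toReal
  set r' := (1 / p').toReal
  have e : ∫⁻ t in Ioi (0:ℝ), decRear f t * decRear g t =
      ∫⁻ t in Ioi (0:ℝ), (ENNReal.ofReal (t ^ r) * decRear f t) *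
        (ENNReal.ofReal (t ^ r') * decRear g t) / ENNReal.ofReal t := by
    refine setLIntegral_congr_fun measurableSet_Ioi fun t ht => ?_
    have ht0 : (0:ℝ) < t := ht
    have ht' : ENNReal.ofReal t ≠ 0 := by simpa using ht0
    rw [mul_mul_mul_comm, ← ENNReal.ofReal_mul (by positivity), ← Real.rpow_add ht0, hr,
      Real.rpow_one, mul_comm (ENNReal.ofReal t), mul_div_assoc,
      ENNReal.div_self ht' ENNReal.ofReal_ne_top, mul_one]
  rw [e]
  by_cases hqt : q = ∞
  · have hq' : q' = 1 := by simpa [hqt] using hqc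
    subst hqt hq'
    simp only [lorentzNorm, if_true, hptop.ne, if_false, ENNReal.one_ne_top, ENNReal.toReal_one,
      ENNReal.rpow_one, div_one]
    exact holder_one (wt_meas g r') _ fun t ht =>
      le_iSup (fun t : {t : ℝ // 0 < t} => ENNReal.ofReal (t.1 ^ r) * decRear f t.1) ⟨t, ht⟩
  by_cases hqt' : q' = ∞
  · have hq' : q = 1 := by simpa [hqt'] using hqc
    subst hqt' hq'
    simp only [lorentzNorm, if_true, hp'top, if_false, ENNReal.one_ne_top, ENNReal.toReal_one,
      ENNReal.rpow_one, div_one]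
    rw [mul_comm (lintegral _ _)]
    refine le_trans (le_of_eq ?_) (holder_one
      (A := fun t => ENNReal.ofReal (t ^ r') * decRear g t) (wt_meas f r) _ fun t ht =>
      le_iSup (fun t : {t : ℝ // 0 < t} => ENNReal.ofReal (t.1 ^ r') * decRear g t.1) ⟨t, ht⟩)
    refine lintegral_congr fun t => ?_
    rw [mul_comm (ENNReal.ofReal (t ^ r) * decRear f t)]
  · simp only [lorentzNorm, hqt, hqt', if_false]
    refine holder_mid (wt_meas f r) (wt_meas g r') ?_
    have hi : 1 / q ≠ ∞ := by intro h; rw [h] at hqc; simp at hqc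
    have hi' : 1 / q' ≠ ∞ := by intro h; rw [h] at hqc; simp at hqc
    have h1 : q ≠ 0 := by rintro rfl; simp at hi
    have h2 : q' ≠ 0 := by rintro rfl; simp at hi'
    have hs : (1 / q).toReal + (1 / q').toReal = 1 := by
      rw [← ENNReal.toReal_add hi hi', hqc]; rfl
    rw [one_div, one_div, ENNReal.toReal_inv, ENNReal.toReal_inv] at hs
    exact ⟨by simpa using hs, ENNReal.toReal_pos h1 hqt, ENNReal.toReal_pos h2 hqt'⟩

/-- O'Neil-type convolution estimate in the limit case `L^∞`. -/
theorem statement_5 (n : ℕ) (p p' q q' : ℝ≥0∞)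
    (hp : 1 < p) (hptop : p < ⊤) (hq : 1 ≤ q)
    (hpc : 1 / p + 1 / p' = 1) (hqc : 1 / q + 1 / q' = 1) :
    ∃ C > (0:ℝ), ∀ f g : Eucl n → ℝ, Measurable f → Measurable g →
      eLpNorm (fun x => ∫ y, f y * g (x - y)) ∞ volume ≤
        ENNReal.ofReal C * lorentzNorm p q f * lorentzNorm p' q' g := by
  refine ⟨1, one_pos, fun f g hf hg => ?_⟩
  rw [ENNReal.ofReal_one, one_mul, eLpNorm_exponent_top]
  refine eLpNormEssSup_le_of_ae_enorm_bound (Filter.Eventually.of_forall fun x => ?_)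
  calc ‖∫ y, f y * g (x - y)‖ₑ ≤ ∫⁻ y, ‖f y * g (x - y)‖ₑ := enorm_integral_le_lintegral_enorm _
    _ = ∫⁻ y, ‖f y‖ₑ * ‖g (x - y)‖ₑ := by simp_rw [enorm_mul]
    _ ≤ ∫⁻ t in Ioi (0:ℝ), decRear f t * decRear (fun y => g (x - y)) t :=
        hardyLittlewood hf (by fun_prop)
    _ = ∫⁻ t in Ioi (0:ℝ), decRear f t * decRear g t := by rw [decRear_comp hg]
    _ ≤ _ := lorentz_holder hp hptop hq hpc hqc f g

end
end

section
/- For every p ∈ (1,∞) and q ∈ [1,∞] there exists a constant C > 0 such that for every ball B_r ⊂ ℝⁿ and every f ∈ C_c^∞(B_r): ‖f‖_{(p,q),ℝⁿ} ≤ C r^{n/2} ‖Δ^{n/4} f‖_{(p,∞),ℝⁿ}. -/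
open MeasureTheory Real FourierTransform Metric Set Matrix
open scoped ENNReal Topology NNReal

noncomputable section

/-- The heat kernel. -/
def hk (n : ℕ) (t : ℝ) (z : Eucl n) : ℝ :=
  (π / (4 * π ^ 2 * t)) ^ ((n : ℝ) / 2) * Real.exp (-π ^ 2 * ‖z‖ ^ 2 / (4 * π ^ 2 * t))

lemma hk_nonneg (n : ℕ) {t : ℝ} (ht : 0 < t) (z : Eucl n) : 0 ≤ hk n t z := by
  unfold hk; positivity

lemma hk_le (n : ℕ) {t : ℝ} (ht : 0 < t) (z : Eucl n) :
    hk n t z ≤ (π / (4 * π ^ 2 * t)) ^ ((n : ℝ) / 2) := by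
  unfold hk
  apply mul_le_of_le_one_right (by positivity)
  apply Real.exp_le_one_iff.2
  apply div_nonpos_of_nonpos_of_nonneg _ (by positivity)
  have : 0 ≤ π ^ 2 * ‖z‖ ^ 2 := by positivity
  linarith

lemma hk_continuous (n : ℕ) (t : ℝ) : Continuous (hk n t) := by
  unfold hk; fun_prop

lemma gauss_integrable (n : ℕ) {b : ℝ} (hb : 0 < b) :
    Integrable (fun v : Eucl n => Real.exp (-b * ‖v‖ ^ 2)) := by
  have h := GaussianFourier.integrable_cexp_neg_mul_sq_norm_add (V := Eucl n)
    (b := (b : ℂ)) (by simpa using hb) 0 0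
  have := h.norm
  refine this.congr (Filter.Eventually.of_forall fun v => ?_)
  simp only [Complex.norm_exp]
  congr 1
  simp [← Complex.ofReal_pow]

lemma hk_lintegral (n : ℕ) {t : ℝ} (ht : 0 < t) :
    ∫⁻ z : Eucl n, ENNReal.ofReal (hk n t z) = 1 := by
  have hb : 0 < 1 / (4 * t) := by positivity
  have e : ∀ z : Eucl n, hk n t z = (π / (4 * π ^ 2 * t)) ^ ((n : ℝ) / 2) *
      Real.exp (-(1 / (4 * t)) * ‖z‖ ^ 2) := by
    intro z; unfold hk; congr 2
    have := Real.pi_pos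
    field_simp
  rw [← ofReal_integral_eq_lintegral_ofReal]
  · simp_rw [e]
    rw [integral_const_mul, GaussianFourier.integral_rexp_neg_mul_sq_norm hb]
    simp only [finrank_euclideanSpace, Fintype.card_fin]
    rw [← Real.mul_rpow (by positivity) (by positivity)]
    have : π / (4 * π ^ 2 * t) * (π / (1 / (4 * t))) = 1 := by
      have := Real.pi_pos
      field_simp
    rw [this]; simp
  · exact ((gauss_integrable n hb).const_mul _).congr (Filter.Eventually.of_forall fun z => (e z).symm)
  · exact Filter.Eventually.of_forall fun z => hk_nonneg n ht z

/-- modulated gaussian -/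
def mg (n : ℕ) (t : ℝ) (x : Eucl n) (ξ : Eucl n) : ℂ :=
  Complex.exp (-((4 * π ^ 2 * t : ℝ) : ℂ) * ‖ξ‖ ^ 2 + 2 * π * Complex.I * (inner ℝ x ξ : ℝ))

lemma mg_continuous (n : ℕ) (t : ℝ) (x : Eucl n) : Continuous (mg n t x) := by
  unfold mg; fun_prop

lemma mg_eq (n : ℕ) (t : ℝ) (x ξ : Eucl n) :
    mg n t x ξ = (Real.exp (-(4 * π ^ 2 * ‖ξ‖ ^ 2 * t)) : ℝ) *
      Complex.exp (2 * π * Complex.I * (inner ℝ x ξ : ℝ)) := by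
  unfold mg
  rw [Complex.exp_add, Complex.ofReal_exp]
  congr 2
  push_cast; ring

lemma norm_char (n : ℕ) (x ξ : Eucl n) :
    ‖Complex.exp (2 * π * Complex.I * (inner ℝ x ξ : ℝ))‖ = 1 := by
  have : (2 * π * Complex.I * (inner ℝ x ξ : ℝ) : ℂ) = ((2 * π * inner ℝ x ξ : ℝ) : ℂ) * Complex.I := by
    push_cast; ring
  rw [this, Complex.norm_exp_ofReal_mul_I]

lemma mg_norm (n : ℕ) (t : ℝ) (x ξ : Eucl n) :
    ‖mg n t x ξ‖ = Real.exp (-(4 * π ^ 2 * ‖ξ‖ ^ 2 * t)) := by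
  rw [mg_eq, norm_mul, norm_char, mul_one, Complex.norm_real, Real.norm_of_nonneg (by positivity)]

lemma mg_integrable (n : ℕ) {t : ℝ} (ht : 0 < t) (x : Eucl n) : Integrable (mg n t x) := by
  exact GaussianFourier.integrable_cexp_neg_mul_sq_norm_add
    (b := ((4 * π ^ 2 * t : ℝ) : ℂ)) (by rw [Complex.ofReal_re]; positivity) _ x

lemma mg_fourier (n : ℕ) {t : ℝ} (ht : 0 < t) (x y : Eucl n) :
    𝓕 (mg n t x) y = (hk n t (x - y) : ℂ) := by
  have := fourier_gaussian_innerProductSpace' (V := Eucl n)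
    (b := ((4 * π ^ 2 * t : ℝ) : ℂ)) (by rw [Complex.ofReal_re]; positivity) x y
  unfold mg
  rw [this]
  unfold hk
  simp only [finrank_euclideanSpace, Fintype.card_fin]
  rw [Complex.ofReal_mul ((π / (4 * π ^ 2 * t)) ^ ((n : ℝ) / 2)), Complex.ofReal_exp,
    Complex.ofReal_cpow (by positivity)]
  push_cast
  rfl

lemma hk_integrable (n : ℕ) {t : ℝ} (ht : 0 < t) (x : Eucl n) :
    Integrable (fun y => hk n t (x - y)) := by
  have h : Integrable (hk n t) := by
    refine ⟨(hk_continuous n t).aestronglyMeasurable, ?_⟩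
    rw [hasFiniteIntegral_iff_ofReal (Filter.Eventually.of_forall fun z => hk_nonneg n ht z),
      hk_lintegral n ht]
    simp
  exact h.comp_sub_left x

lemma hk_conv (n : ℕ) {t : ℝ} (ht : 0 < t) (x : Eucl n) (G : Eucl n → ℂ) (hG : Integrable G) :
    ∫ y, 𝓕⁻ G y * (hk n t (x - y) : ℂ) = ∫ ξ, G ξ * mg n t x ξ := by
  have hΦ : 𝓕 (mg n t x) = fun y => (hk n t (x - y) : ℂ) := by
    ext y; exact mg_fourier n ht x y
  have hi : Integrable (fun y => (hk n t (x - y) : ℂ)) := (hk_integrable n ht x).ofReal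
  have inv : 𝓕⁻ (fun y => (hk n t (x - y) : ℂ)) = mg n t x := by
    rw [← hΦ]
    exact (mg_continuous n t x).fourierInv_fourier_eq (mg_integrable n ht x) (by rw [hΦ]; exact hi)
  have key := VectorFourier.integral_fourierIntegral_smul_eq_flip (L := -innerₗ (Eucl n))
    (μ := volume) (ν := volume)
    (f := G) (g := fun y => (hk n t (x - y) : ℂ)) Real.continuous_fourierChar
    (by simpa using (continuous_inner (𝕜 := ℝ) (E := Eucl n)).fun_neg) hG hi
  have hf : (-innerₗ (Eucl n)).flip = -innerₗ (Eucl n) := by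
    ext a b; simp [real_inner_comm]
  rw [hf] at key
  change ∫ y, 𝓕⁻ G y • (hk n t (x - y) : ℂ) = ∫ ξ, G ξ • 𝓕⁻ (fun y => (hk n t (x - y) : ℂ)) ξ at key
  rw [inv] at key
  exact key

lemma gamma_cut {a T L : ℝ} (ha : 0 < a) (hT : 0 < T) (hL : 0 < L) :
    |1 - L ^ a * ∫ t in Ioc 0 T, t ^ (a - 1) / Real.Gamma a * Real.exp (-(L * t))|
      ≤ 2 ^ a * Real.exp (-(T * L / 2)) := by
  have hΓ := Real.Gamma_pos_of_pos ha
  have h0 : ∀ M : ℝ, 0 < M → ∫ t in Ioi 0, t ^ (a - 1) / Real.Gamma a * Real.exp (-(M * t)) = M ^ (-a) := by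
    intro M hM
    have := Real.integral_rpow_mul_exp_neg_mul_Ioi ha hM
    have e : ∀ t : ℝ, t ^ (a - 1) / Real.Gamma a * Real.exp (-(M * t)) =
      (Real.Gamma a)⁻¹ * (t ^ (a - 1) * Real.exp (-(M * t))) := by intro t; ring
    simp_rw [e]
    rw [integral_const_mul, this, one_div, Real.inv_rpow hM.le, Real.rpow_neg hM.le]
    field_simp
  have hInt0 : ∀ M : ℝ, 0 < M → IntegrableOn (fun t => t ^ (a - 1) / Real.Gamma a * Real.exp (-(M * t))) (Ioi 0) := by
    intro M hM
    by_contra hc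
    have := h0 M hM
    rw [integral_undef hc] at this
    have : 0 < M ^ (-a) := by positivity
    linarith
  have hsplit := h0 L hL
  rw [← Ioc_union_Ioi_eq_Ioi hT.le, setIntegral_union (Ioc_disjoint_Ioi le_rfl) measurableSet_Ioi
    ((hInt0 L hL).mono_set Ioc_subset_Ioi_self) ((hInt0 L hL).mono_set (Ioi_subset_Ioi hT.le))] at hsplit
  have hone : L ^ a * L ^ (-a) = 1 := by rw [← Real.rpow_add hL]; simp
  have e1 : 1 - L ^ a * ∫ t in Ioc 0 T, t ^ (a - 1) / Real.Gamma a * Real.exp (-(L * t))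
      = L ^ a * ∫ t in Ioi T, t ^ (a - 1) / Real.Gamma a * Real.exp (-(L * t)) := by
    linear_combination (-1 : ℝ) * hone - L ^ a * hsplit
  rw [e1, abs_of_nonneg]
  · have b1 : ∫ t in Ioi T, t ^ (a - 1) / Real.Gamma a * Real.exp (-(L * t)) ≤
        ∫ t in Ioi T, Real.exp (-(T * L / 2)) * (t ^ (a - 1) / Real.Gamma a * Real.exp (-(L / 2 * t))) := by
      apply setIntegral_mono_on ((hInt0 L hL).mono_set (Ioi_subset_Ioi hT.le))
        (((hInt0 (L/2) (by positivity)).mono_set (Ioi_subset_Ioi hT.le)).const_mul _) measurableSet_Ioi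
      intro t ht
      have ht' : T < t := ht
      have : 0 < t := hT.trans ht'
      rw [mul_left_comm, ← Real.exp_add]
      gcongr
      nlinarith
    have b2 : ∫ t in Ioi T, (t ^ (a - 1) / Real.Gamma a * Real.exp (-(L / 2 * t))) ≤ (L/2) ^ (-a) := by
      rw [← h0 (L/2) (by positivity)]
      apply setIntegral_mono_set (hInt0 (L/2) (by positivity))
      · filter_upwards [ae_restrict_mem measurableSet_Ioi] with t ht
        have : (0:ℝ) < t := ht
        simp only [Pi.zero_apply]
        positivity
      · exact (Ioi_subset_Ioi hT.le).eventuallyLE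
    rw [integral_const_mul] at b1
    calc _ ≤ L ^ a * (Real.exp (-(T * L / 2)) * (L/2) ^ (-a)) := by
          gcongr
          exact b1.trans (by gcongr)
      _ = 2 ^ a * Real.exp (-(T * L / 2)) := by
          rw [Real.div_rpow hL.le (by norm_num), Real.rpow_neg (by norm_num : (0:ℝ) ≤ 2)]
          rw [div_inv_eq_mul]
          linear_combination (2 ^ a * Real.exp (-(T * L / 2))) * hone
  · apply mul_nonneg (by positivity)
    apply setIntegral_nonneg measurableSet_Ioi
    intro t ht
    have : 0 < t := hT.trans ht
    positivity

/-- the Fourier side of the fractional Laplacian -/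
def Gf {n : ℕ} (s : ℝ) (f : Eucl n → ℝ) : Eucl n → ℂ := fun ξ : Eucl n =>
    (((2 * π * ‖ξ‖) ^ s : ℝ) : ℂ) * 𝓕 (fun y : Eucl n => (f y : ℂ)) ξ

lemma fracLap_eq {n : ℕ} (s : ℝ) (f : Eucl n → ℝ) (x : Eucl n) :
    fracLap s f x = (𝓕⁻ (Gf s f) x).re := rfl

lemma test_schwartz {n : ℕ} {f : Eucl n → ℝ} (hf : ContDiff ℝ (⊤ : ℕ∞) f)
    (hc : HasCompactSupport f) :
    ∃ φ : SchwartzMap (Eucl n) ℂ, (φ : Eucl n → ℂ) = fun y => (f y : ℂ) := by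
  have h1 : HasCompactSupport (fun y => (f y : ℂ)) := hc.comp_left (g := fun r : ℝ => (r : ℂ)) rfl
  have h2 : ContDiff ℝ (⊤ : ℕ∞) (fun y => (f y : ℂ)) := Complex.ofRealCLM.contDiff.comp hf
  exact ⟨h1.toSchwartzMap h2, rfl⟩

lemma fh_props {n : ℕ} {f : Eucl n → ℝ} (hf : ContDiff ℝ (⊤ : ℕ∞) f)
    (hc : HasCompactSupport f) :
    Continuous (𝓕 (fun y : Eucl n => (f y : ℂ))) ∧
    ∀ k : ℕ, Integrable (fun ξ => ‖ξ‖ ^ k * ‖𝓕 (fun y : Eucl n => (f y : ℂ)) ξ‖) := by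
  obtain ⟨φ, hφ⟩ := test_schwartz hf hc
  rw [← hφ, ← SchwartzMap.fourier_coe]
  exact ⟨(𝓕 φ).continuous, fun k => (𝓕 φ).integrable_pow_mul volume k⟩

lemma fh_integrable {n : ℕ} {f : Eucl n → ℝ} (hf : ContDiff ℝ (⊤ : ℕ∞) f)
    (hc : HasCompactSupport f) : Integrable (𝓕 (fun y : Eucl n => (f y : ℂ))) := by
  obtain ⟨h1, h2⟩ := fh_props hf hc
  have := h2 0
  simp only [pow_zero, one_mul] at this
  exact (integrable_norm_iff h1.aestronglyMeasurable).1 this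

lemma Gf_integrable {n : ℕ} {s : ℝ} (hs : 0 ≤ s) {f : Eucl n → ℝ} (hf : ContDiff ℝ (⊤ : ℕ∞) f)
    (hc : HasCompactSupport f) : Integrable (Gf s f) := by
  obtain ⟨h1, h2⟩ := fh_props hf hc
  obtain ⟨k, hk⟩ := exists_nat_ge s
  have hcont : Continuous (Gf s f) := by
    unfold Gf
    refine Continuous.mul ?_ h1
    refine Complex.continuous_ofReal.comp ?_
    exact Continuous.rpow_const (by fun_prop) (fun _ => Or.inr hs)
  refine Integrable.mono' (((h2 0).add ((h2 k).const_mul ((2 * π) ^ k)))) hcont.aestronglyMeasurable ?_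
  refine Filter.Eventually.of_forall fun ξ => ?_
  unfold Gf
  rw [norm_mul, Complex.norm_real, Real.norm_of_nonneg (by positivity)]
  simp only [Pi.add_apply, pow_zero, one_mul]
  rw [← mul_assoc, ← mul_pow, ← one_add_mul]
  gcongr
  have hx : 0 ≤ 2 * π * ‖ξ‖ := by positivity
  rcases le_total (2 * π * ‖ξ‖) 1 with h | h
  · have := Real.rpow_le_one hx h hs
    have : 0 ≤ (2 * π * ‖ξ‖) ^ k := by positivity
    linarith
  · have := Real.rpow_le_rpow_of_exponent_le h hk
    rw [Real.rpow_natCast] at this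
    linarith

lemma fourierInv_continuous {n : ℕ} {G : Eucl n → ℂ} (hG : Integrable G) :
    Continuous (𝓕⁻ G) :=
  VectorFourier.fourierIntegral_continuous (L := -innerₗ (Eucl n)) Real.continuous_fourierChar
    (by simpa using (continuous_inner (𝕜 := ℝ) (E := Eucl n)).fun_neg) hG

lemma fracLap_continuous {n : ℕ} {s : ℝ} (hs : 0 ≤ s) {f : Eucl n → ℝ} (hf : ContDiff ℝ (⊤ : ℕ∞) f)
    (hc : HasCompactSupport f) : Continuous (fracLap s f) :=
  Complex.continuous_re.comp (fourierInv_continuous (Gf_integrable hs hf hc))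

lemma Gf_conj {n : ℕ} (s : ℝ) (f : Eucl n → ℝ) (ξ : Eucl n) :
    (starRingEnd ℂ) (Gf s f (-ξ)) = Gf s f ξ := by
  unfold Gf
  rw [map_mul, Complex.conj_ofReal, norm_neg]
  congr 1
  rw [Real.fourier_eq', Real.fourier_eq', ← integral_conj]
  congr 1 with v
  simp only [smul_eq_mul, map_mul, Complex.conj_ofReal, ← Complex.exp_conj, Complex.conj_I]
  congr 2
  simp

lemma fracLap_real {n : ℕ} (s : ℝ) (f : Eucl n → ℝ) (x : Eucl n) :
    𝓕⁻ (Gf s f) x = (fracLap s f x : ℂ) := by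
  rw [fracLap_eq]
  symm
  apply Complex.conj_eq_iff_re.1
  rw [Real.fourierInv_eq', ← integral_conj, ← integral_neg_eq_self]
  congr 1 with v
  simp only [smul_eq_mul, map_mul, Gf_conj, Complex.conj_ofReal, ← Complex.exp_conj, Complex.conj_I]
  congr 2
  simp

/-- low-frequency remainder constant -/
def C2 (n : ℕ) : ℝ := 2 ^ ((n : ℝ) / 4) * (π / (2 * π ^ 2)) ^ ((n : ℝ) / 2)

lemma fh_bound {n : ℕ} (f : Eucl n → ℝ) (ξ : Eucl n) :
    ‖𝓕 (fun y : Eucl n => (f y : ℂ)) ξ‖ₑ ≤ ∫⁻ y, ENNReal.ofReal |f y| := by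
  rw [Real.fourier_eq]
  refine (enorm_integral_le_lintegral_enorm _).trans (lintegral_mono fun y => ?_)
  rw [← ofReal_norm]
  simp

lemma tint {a : ℝ} (ha : 0 < a) (T : ℝ) :
    IntegrableOn (fun t : ℝ => t ^ (a - 1) / Real.Gamma a) (Ioc 0 T) := by
  rcases le_total T 0 with h | h
  · simp [Ioc_eq_empty_of_le h]
  · have := (intervalIntegral.intervalIntegrable_rpow' (a := 0) (b := T) (r := a - 1) (by linarith))
    rw [intervalIntegrable_iff_integrableOn_Ioc_of_le h] at this
    exact this.div_const _

lemma rep (n : ℕ) (hn : 1 ≤ n) {f : Eucl n → ℝ} (hf : ContDiff ℝ (⊤ : ℕ∞) f)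
    (hc : HasCompactSupport f) {T : ℝ} (hT : 0 < T) (x : Eucl n) :
    ENNReal.ofReal |f x| ≤ (∫⁻ t in Ioc 0 T, ENNReal.ofReal (t ^ ((n : ℝ) / 4 - 1) / Real.Gamma ((n : ℝ) / 4)) *
        ∫⁻ y, ENNReal.ofReal |fracLap ((n : ℝ) / 2) f y| * ENNReal.ofReal (hk n t (x - y)))
      + ENNReal.ofReal (C2 n * T ^ (-(n : ℝ) / 2)) * ∫⁻ y, ENNReal.ofReal |f y| := by
  set a : ℝ := (n : ℝ) / 4 with ha_def
  have hn' : (0 : ℝ) < n := by exact_mod_cast hn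
  have ha : 0 < a := by positivity
  have hΓ := Real.Gamma_pos_of_pos ha
  set fh := 𝓕 (fun y : Eucl n => (f y : ℂ)) with hfh
  set G := Gf ((n : ℝ) / 2) f with hGdef
  have hG : Integrable G := Gf_integrable (by positivity) hf hc
  have hfi := fh_integrable hf hc
  rw [← hfh] at hfi
  let L : Eucl n → ℝ := fun ξ => 4 * π ^ 2 * ‖ξ‖ ^ 2
  have hGL : ∀ ξ, G ξ = ((L ξ ^ a : ℝ) : ℂ) * fh ξ := by
    intro ξ
    simp only [hGdef, Gf]
    congr 2
    have : L ξ = (2 * π * ‖ξ‖) ^ (2 : ℝ) := by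
      rw [Real.rpow_two]; simp only [L]; ring
    rw [this, ← Real.rpow_mul (by positivity)]
    congr 1
    rw [ha_def]; ring
  let Φ : Eucl n → ℂ := fun ξ => Complex.exp (2 * π * Complex.I * (inner ℝ x ξ : ℝ))
  have hΦn : ∀ ξ, ‖Φ ξ‖ = 1 := fun ξ => norm_char n x ξ
  have hΦc : Continuous Φ := by simp only [Φ]; fun_prop
  let κ : Eucl n → ℝ := fun ξ => ∫ t in Ioc 0 T, t ^ (a - 1) / Real.Gamma a * Real.exp (-(L ξ * t))
  -- the product function
  let H : Eucl n × ℝ → ℂ := fun z => ((z.2 ^ (a - 1) / Real.Gamma a : ℝ) : ℂ) * (G z.1 * mg n z.2 x z.1)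
  have hH : Integrable H ((volume : Measure (Eucl n)).prod (volume.restrict (Ioc 0 T))) := by
    have base : Integrable (fun z : Eucl n × ℝ => G z.1 * ((z.2 ^ (a - 1) / Real.Gamma a : ℝ) : ℂ))
        ((volume : Measure (Eucl n)).prod (volume.restrict (Ioc 0 T))) :=
      hG.mul_prod (tint ha T).ofReal
    have hpos : ∀ᵐ z : Eucl n × ℝ ∂((volume : Measure (Eucl n)).prod (volume.restrict (Ioc 0 T))), 0 < z.2 := by
      have h1 : ∀ᵐ t ∂(volume.restrict (Ioc 0 T)), 0 < t := by
        filter_upwards [ae_restrict_mem measurableSet_Ioc] with t ht using ht.1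
      exact Measure.quasiMeasurePreserving_snd.ae h1
    have hm : Continuous (fun z : Eucl n × ℝ => mg n z.2 x z.1) := by
      unfold mg; fun_prop
    refine (base.norm.mono' (f := H) ?_ ?_)
    · have := base.aestronglyMeasurable.mul hm.aestronglyMeasurable
      refine this.congr (Filter.Eventually.of_forall fun z => ?_)
      simp only [H, Pi.mul_apply]; ring
    · filter_upwards [hpos] with z hz
      simp only [H, norm_mul, mg_norm]
      have h1 : Real.exp (-(4 * π ^ 2 * ‖z.1‖ ^ 2 * z.2)) ≤ 1 := by
        apply Real.exp_le_one_iff.2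
        have : 0 ≤ 4 * π ^ 2 * ‖z.1‖ ^ 2 * z.2 := by positivity
        linarith
      rw [mul_comm]
      gcongr
      exact mul_le_of_le_one_right (norm_nonneg _) h1
  have hHin : ∀ ξ, ∫ t in Ioc 0 T, H (ξ, t) = (κ ξ : ℂ) * (G ξ * Φ ξ) := by
    intro ξ
    simp only [κ]
    rw [← integral_complex_ofReal, ← integral_mul_const]
    congr 1 with t
    simp only [H, mg_eq, L, Φ]
    push_cast; ring
  have hκi : Integrable (fun ξ => (κ ξ : ℂ) * (G ξ * Φ ξ)) := by
    refine hH.integral_prod_left.congr (Filter.Eventually.of_forall fun ξ => hHin ξ)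
  have hΦfi : Integrable (fun ξ => Φ ξ * fh ξ) :=
    hfi.bdd_mul hΦc.aestronglyMeasurable (Filter.Eventually.of_forall fun ξ => (hΦn ξ).le)
  have hinv : (f x : ℂ) = ∫ ξ, Φ ξ * fh ξ := by
    obtain ⟨φ, hφ⟩ := test_schwartz hf hc
    have hcont : Continuous (fun y : Eucl n => (f y : ℂ)) := by rw [← hφ]; exact φ.continuous
    have hInt0 : Integrable (fun y : Eucl n => (f y : ℂ)) := by rw [← hφ]; exact φ.integrable
    have := congrFun (hcont.fourierInv_fourier_eq hInt0 hfi) x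
    rw [← this, Real.fourierInv_eq']
    congr 1 with ξ
    simp only [smul_eq_mul, Φ]
    congr 2
    rw [real_inner_comm]
    push_cast; ring
  have hdecomp : (f x : ℂ) = (∫ ξ, (Φ ξ * fh ξ - (κ ξ : ℂ) * (G ξ * Φ ξ))) +
      ∫ t in Ioc 0 T, ((t ^ (a - 1) / Real.Gamma a : ℝ) : ℂ) *
        ∫ y, (fracLap ((n : ℝ) / 2) f y : ℂ) * (hk n t (x - y) : ℂ) := by
    rw [integral_sub hΦfi hκi, ← hinv]
    have e1 : ∫ ξ, (κ ξ : ℂ) * (G ξ * Φ ξ) = ∫ ξ, ∫ t in Ioc 0 T, H (ξ, t) := by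
      congr 1 with ξ; exact (hHin ξ).symm
    have e2 : ∫ t in Ioc 0 T, ((t ^ (a - 1) / Real.Gamma a : ℝ) : ℂ) *
        ∫ y, (fracLap ((n : ℝ) / 2) f y : ℂ) * (hk n t (x - y) : ℂ) =
        ∫ t in Ioc 0 T, ∫ ξ, H (ξ, t) := by
      apply setIntegral_congr_fun measurableSet_Ioc
      intro t ht
      simp only [H]
      rw [integral_const_mul, ← hk_conv n ht.1 x G hG]
      congr 2 with y
      rw [fracLap_real]
    rw [e1, e2, integral_integral_swap (f := fun ξ t => H (ξ, t)) hH]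
    ring
  have hL0 : ∀ᵐ ξ : Eucl n, 0 < L ξ := by
    have : Nonempty (Fin n) := ⟨⟨0, hn⟩⟩
    have h0 : ∀ᵐ ξ : Eucl n, ξ ≠ 0 := by
      simp [ae_iff]
    filter_upwards [h0] with ξ hξ
    have : 0 < ‖ξ‖ := norm_pos_iff.2 hξ
    simp only [L]; positivity
  have hrem : ‖∫ ξ, (Φ ξ * fh ξ - (κ ξ : ℂ) * (G ξ * Φ ξ))‖ₑ ≤
      ENNReal.ofReal (C2 n * T ^ (-(n : ℝ) / 2)) * ∫⁻ y, ENNReal.ofReal |f y| := by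
    have hb : 0 < 2 * π ^ 2 * T := by positivity
    calc ‖∫ ξ, (Φ ξ * fh ξ - (κ ξ : ℂ) * (G ξ * Φ ξ))‖ₑ
        ≤ ∫⁻ ξ, ‖Φ ξ * fh ξ - (κ ξ : ℂ) * (G ξ * Φ ξ)‖ₑ := enorm_integral_le_lintegral_enorm _
      _ ≤ ∫⁻ ξ, ENNReal.ofReal (2 ^ a * Real.exp (-(2 * π ^ 2 * T) * ‖ξ‖ ^ 2)) * ∫⁻ y, ENNReal.ofReal |f y| := by
          apply lintegral_mono_ae
          filter_upwards [hL0] with ξ hξ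
          have e : Φ ξ * fh ξ - (κ ξ : ℂ) * (G ξ * Φ ξ) =
              ((1 - L ξ ^ a * κ ξ : ℝ) : ℂ) * Φ ξ * fh ξ := by
            rw [hGL]; push_cast; ring
          rw [e, enorm_mul, enorm_mul, ← ofReal_norm (Φ ξ), hΦn, ENNReal.ofReal_one, mul_one]
          gcongr
          · rw [← ofReal_norm, Complex.norm_real, Real.norm_eq_abs]
            apply ENNReal.ofReal_le_ofReal
            refine (gamma_cut ha hT hξ).trans_eq ?_
            congr 2
            simp only [L]; ring
          · exact fh_bound f ξ
      _ = ENNReal.ofReal (C2 n * T ^ (-(n : ℝ) / 2)) * ∫⁻ y, ENNReal.ofReal |f y| := by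
          rw [lintegral_mul_const _ (by fun_prop),
            ← ofReal_integral_eq_lintegral_ofReal ((gauss_integrable n hb).const_mul _)
              (Filter.Eventually.of_forall fun ξ => by positivity),
            integral_const_mul, GaussianFourier.integral_rexp_neg_mul_sq_norm hb]
          have e : (π / (2 * π ^ 2 * T)) ^ ((n : ℝ) / 2) =
              (π / (2 * π ^ 2)) ^ ((n : ℝ) / 2) * T ^ (-(n : ℝ) / 2) := by
            rw [← div_div π (2 * π ^ 2) T, Real.div_rpow (by positivity) hT.le, neg_div,
              Real.rpow_neg hT.le, div_eq_mul_inv]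
          simp only [finrank_euclideanSpace, Fintype.card_fin, C2]
          rw [e, mul_assoc]
  have hmain : ‖∫ t in Ioc 0 T, ((t ^ (a - 1) / Real.Gamma a : ℝ) : ℂ) *
        ∫ y, (fracLap ((n : ℝ) / 2) f y : ℂ) * (hk n t (x - y) : ℂ)‖ₑ ≤
      ∫⁻ t in Ioc 0 T, ENNReal.ofReal (t ^ (a - 1) / Real.Gamma a) *
        ∫⁻ y, ENNReal.ofReal |fracLap ((n : ℝ) / 2) f y| * ENNReal.ofReal (hk n t (x - y)) := by
    refine (enorm_integral_le_lintegral_enorm _).trans (setLIntegral_mono' measurableSet_Ioc ?_)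
    intro t ht
    have ht0 : 0 < t := ht.1
    rw [enorm_mul]
    gcongr
    · rw [← ofReal_norm, Complex.norm_real, Real.norm_of_nonneg (by positivity)]
    · refine (enorm_integral_le_lintegral_enorm _).trans (lintegral_mono fun y => ?_)
      rw [enorm_mul, ← ofReal_norm, ← ofReal_norm, Complex.norm_real, Complex.norm_real,
        Real.norm_eq_abs, Real.norm_of_nonneg (hk_nonneg n ht0 _)]
  have hfe : ENNReal.ofReal |f x| = ‖(f x : ℂ)‖ₑ := by
    rw [← ofReal_norm, Complex.norm_real, Real.norm_eq_abs]
  rw [hfe, hdecomp]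
  refine (enorm_add_le _ _).trans ?_
  rw [add_comm]
  exact add_le_add hmain hrem

lemma weak_bound {n : ℕ} {p : ℝ} (hp : 1 < p) {g : Eucl n → ℝ} {A : ℝ} (hA : 0 < A)
    (hg : lorentzNorm (ENNReal.ofReal p) ∞ g ≤ ENNReal.ofReal A) {l : ℝ} (hl : 0 < l) :
    volume {x | l < |g x|} ≤ ENNReal.ofReal (A ^ p * l ^ (-p)) := by
  have hp0 : 0 < p := by linarith
  rw [lorentzNorm, if_pos rfl, if_neg ENNReal.ofReal_ne_top] at hg
  have e : (1 / ENNReal.ofReal p).toReal = 1 / p := by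
    rw [ENNReal.toReal_div, ENNReal.toReal_ofReal hp0.le]; simp
  rw [e] at hg
  by_contra hcon
  push Not at hcon
  obtain ⟨t, ht1, ht2⟩ := ENNReal.lt_iff_exists_real_btwn.1 hcon
  obtain ⟨ht1, ht3⟩ := ht2
  have hc0 : 0 < A ^ p * l ^ (-p) := by positivity
  have htlt : A ^ p * l ^ (-p) < t := by
    rw [ENNReal.ofReal_lt_ofReal_iff_of_nonneg hc0.le] at ht1
    exact ht1
  have ht0 : 0 < t := hc0.trans htlt
  have h1 := (le_iSup (fun t : {t : ℝ // 0 < t} =>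
    ENNReal.ofReal (t.1 ^ (1 / p)) * decRear g t.1) ⟨t, ht0⟩).trans hg
  have h2 : ENNReal.ofReal l ≤ decRear g t := by
    unfold decRear
    refine le_iInf fun s => le_iInf fun hs => ?_
    by_contra hsl
    push Not at hsl
    have hsl' : (s : ℝ) < l := by
      rw [← ENNReal.ofReal_coe_nnreal] at hsl
      exact (ENNReal.ofReal_lt_ofReal_iff hl).1 hsl
    have : volume {x | l < |g x|} ≤ volume {x : Eucl n | (s : ℝ) < |g x|} :=
      measure_mono fun x hx => lt_trans hsl' hx
    exact absurd (this.trans hs) (not_le.2 ht3)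
  have h3 : ENNReal.ofReal (t ^ (1 / p) * l) ≤ ENNReal.ofReal A := by
    rw [ENNReal.ofReal_mul (by positivity)]
    exact (by gcongr : _ ≤ _).trans h1
  rw [ENNReal.ofReal_le_ofReal_iff hA.le] at h3
  have h4 := Real.rpow_le_rpow (by positivity) h3 hp0.le
  rw [Real.mul_rpow (by positivity) hl.le, ← Real.rpow_mul ht0.le, one_div_mul_cancel hp0.ne',
    Real.rpow_one] at h4
  have : t ≤ A ^ p * l ^ (-p) := by
    rw [Real.rpow_neg hl.le, ← div_eq_mul_inv, le_div_iff₀ (by positivity)]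
    exact h4
  linarith

lemma trunc_bound {n : ℕ} {p : ℝ} (hp : 1 < p) {g : Eucl n → ℝ} (hgm : Measurable g) {A : ℝ} (hA : 0 < A)
    (hg : lorentzNorm (ENNReal.ofReal p) ∞ g ≤ ENNReal.ofReal A) {h : ℝ} (hh : 0 < h) :
    ∫⁻ y, ENNReal.ofReal (|g y| - h) ≤ ENNReal.ofReal (A ^ p * h ^ (1 - p) / (p - 1)) := by
  have e0 : ∀ y, ENNReal.ofReal (|g y| - h) = ENNReal.ofReal (max (|g y| - h) 0) := by
    intro y
    rcases le_total (|g y| - h) 0 with h1 | h1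
    · rw [max_eq_right h1, ENNReal.ofReal_of_nonpos h1]; simp
    · rw [max_eq_left h1]
  simp_rw [e0]
  rw [lintegral_eq_lintegral_meas_lt (f := fun y => max (|g y| - h) 0) volume (Filter.Eventually.of_forall fun y => le_max_right _ _)
    (by fun_prop)]
  have hb : ∀ u ∈ Ioi (0:ℝ), volume {y | u < max (|g y| - h) 0} ≤
      ENNReal.ofReal (A ^ p * (h + u) ^ (-p)) := by
    intro u hu
    have hu' : (0:ℝ) < u := hu
    refine le_trans (measure_mono ?_) (weak_bound hp hA hg (l := h + u) (by positivity))
    intro y hy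
    simp only [mem_ofPred_eq, lt_max_iff] at hy ⊢
    rcases hy with hy | hy
    · linarith
    · linarith
  refine (setLIntegral_mono' measurableSet_Ioi hb).trans ?_
  have e1 : ∫⁻ u in Ioi (0:ℝ), ENNReal.ofReal (A ^ p * (h + u) ^ (-p)) =
      ∫⁻ u in Ioi h, ENNReal.ofReal (A ^ p * u ^ (-p)) := by
    have := (measurePreserving_add_left (volume : Measure ℝ) h).setLIntegral_comp_preimage
      (s := Ioi h) measurableSet_Ioi (f := fun u => ENNReal.ofReal (A ^ p * u ^ (-p))) (by fun_prop)
    rw [← this]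
    congr 2
    ext u; simp
  rw [e1, ← ofReal_integral_eq_lintegral_ofReal]
  · rw [integral_const_mul, integral_Ioi_rpow_of_lt (by linarith) hh]
    apply ENNReal.ofReal_le_ofReal
    apply le_of_eq
    rw [show -p + 1 = 1 - p by ring, neg_div, ← div_neg, neg_sub, mul_div_assoc]
  · exact (integrableOn_Ioi_rpow_of_lt (by linarith) hh).const_mul _
  · filter_upwards [ae_restrict_mem measurableSet_Ioi] with u hu
    have : 0 < u := hh.trans hu
    simp only [Pi.zero_apply]
    positivity

lemma rpow_lint {b T : ℝ} (hb : 0 < b) (hT : 0 < T) :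
    ∫⁻ t in Ioc 0 T, ENNReal.ofReal (t ^ (b - 1)) = ENNReal.ofReal (T ^ b / b) := by
  have hi : IntegrableOn (fun t : ℝ => t ^ (b - 1)) (Ioc 0 T) := by
    have := (intervalIntegral.intervalIntegrable_rpow' (a := 0) (b := T) (r := b - 1) (by linarith))
    rwa [intervalIntegrable_iff_integrableOn_Ioc_of_le hT.le] at this
  rw [← ofReal_integral_eq_lintegral_ofReal hi]
  · rw [← intervalIntegral.integral_of_le hT.le, integral_rpow (Or.inl (by linarith))]
    congr 1
    rw [sub_add_cancel, Real.zero_rpow hb.ne', sub_zero]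
  · filter_upwards [ae_restrict_mem measurableSet_Ioc] with u hu
    have : 0 < u := hu.1
    simp only [Pi.zero_apply]
    positivity

lemma min_pow (z w : ℝ≥0∞) (h1 : w ≤ 1) (h2 : w ≤ z) : w ≤ z ^ (1/4 : ℝ) := by
  rcases le_total z 1 with h | h
  · calc w ≤ z := h2
      _ = z ^ (1:ℝ) := (ENNReal.rpow_one z).symm
      _ ≤ z ^ (1/4:ℝ) := ENNReal.rpow_le_rpow_of_exponent_ge h (by norm_num)
  · exact h1.trans (by
      calc (1:ℝ≥0∞) = 1 ^ (1/4:ℝ) := by simp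
        _ ≤ z ^ (1/4:ℝ) := by gcongr)

lemma heat_est {n : ℕ} {g : Eucl n → ℝ} (hgm : Measurable g) {S : Set (Eucl n)}
    {h t : ℝ} (ht : 0 < t) :
    ∫⁻ x in S, ∫⁻ y, ENNReal.ofReal |g y| * ENNReal.ofReal (hk n t (x - y)) ≤
      ENNReal.ofReal h * volume S + (∫⁻ y, ENNReal.ofReal (|g y| - h)) *
        (volume S * ENNReal.ofReal ((π / (4 * π ^ 2 * t)) ^ ((n : ℝ) / 2))) ^ (1/4 : ℝ) := by
  have hm : Measurable (fun z : Eucl n × Eucl n => ENNReal.ofReal (hk n t (z.1 - z.2))) :=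
    ((hk_continuous n t).comp (by fun_prop : Continuous fun z : Eucl n × Eucl n => z.1 - z.2)).measurable.ennreal_ofReal
  have hm1 : ∀ y : Eucl n, Measurable (fun x : Eucl n => ENNReal.ofReal (hk n t (x - y))) :=
    fun y => ((hk_continuous n t).comp (by fun_prop : Continuous fun x : Eucl n => x - y)).measurable.ennreal_ofReal
  have tr1 : ∀ y : Eucl n, ∫⁻ x, ENNReal.ofReal (hk n t (x - y)) = 1 := by
    intro y
    rw [lintegral_sub_right_eq_self (fun x => ENNReal.ofReal (hk n t x)) y, hk_lintegral n ht]
  have tr2 : ∀ x : Eucl n, ∫⁻ y, ENNReal.ofReal (hk n t (x - y)) = 1 := by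
    intro x
    rw [lintegral_sub_left_eq_self (fun x => ENNReal.ofReal (hk n t x)) x, hk_lintegral n ht]
  let ψ : Eucl n → ℝ≥0∞ := fun y => ∫⁻ x in S, ENNReal.ofReal (hk n t (x - y))
  have hψm : Measurable ψ := Measurable.lintegral_prod_left' hm
  have hψ1 : ∀ y, ψ y ≤ (volume S * ENNReal.ofReal ((π / (4 * π ^ 2 * t)) ^ ((n : ℝ) / 2))) ^ (1/4 : ℝ) := by
    intro y
    apply min_pow
    · exact (setLIntegral_le_lintegral _ _).trans (tr1 y).le
    · calc ψ y ≤ ∫⁻ x in S, ENNReal.ofReal ((π / (4 * π ^ 2 * t)) ^ ((n : ℝ) / 2)) :=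
            lintegral_mono fun x => ENNReal.ofReal_le_ofReal (hk_le n ht _)
        _ = _ := by rw [setLIntegral_const, mul_comm]
  have hψ2 : ∫⁻ y, ψ y = volume S := by
    simp only [ψ]
    rw [lintegral_lintegral_swap (f := fun y x => ENNReal.ofReal (hk n t (x - y)))
      (by exact (hm.comp measurable_swap).aemeasurable)]
    simp_rw [tr2]
    simp
  calc ∫⁻ x in S, ∫⁻ y, ENNReal.ofReal |g y| * ENNReal.ofReal (hk n t (x - y))
      = ∫⁻ y, ENNReal.ofReal |g y| * ψ y := by
        rw [lintegral_lintegral_swap]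
        · congr 1 with y
          rw [lintegral_const_mul _ (hm1 y)]
        · apply Measurable.aemeasurable
          exact Measurable.mul (by fun_prop) hm
    _ ≤ ∫⁻ y, (ENNReal.ofReal h * ψ y + ENNReal.ofReal (|g y| - h) *
          (volume S * ENNReal.ofReal ((π / (4 * π ^ 2 * t)) ^ ((n : ℝ) / 2))) ^ (1/4 : ℝ)) := by
        apply lintegral_mono
        intro y
        calc ENNReal.ofReal |g y| * ψ y ≤ (ENNReal.ofReal h + ENNReal.ofReal (|g y| - h)) * ψ y := by
              gcongr
              refine le_trans (le_of_eq ?_) ENNReal.ofReal_add_le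
              congr 1; ring
          _ ≤ _ := by
              rw [add_mul]
              exact add_le_add le_rfl (mul_le_mul' le_rfl (hψ1 y))
    _ = _ := by
        rw [lintegral_add_left (by fun_prop), lintegral_const_mul _ hψm, hψ2,
          lintegral_mul_const _ (by fun_prop)]

def K1 (n : ℕ) : ℝ := 1 / (Real.Gamma ((n : ℝ) / 4) * ((n : ℝ) / 4))

def K2 (n : ℕ) (p : ℝ) : ℝ :=
  (π / (4 * π ^ 2)) ^ ((n : ℝ) / 8) / (Real.Gamma ((n : ℝ) / 4) * (p - 1) * ((n : ℝ) / 8))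

lemma S_est {n : ℕ} (hn : 1 ≤ n) {p : ℝ} (hp : 1 < p) {f : Eucl n → ℝ} (hf : ContDiff ℝ (⊤ : ℕ∞) f)
    (hc : HasCompactSupport f) {A : ℝ} (hA : 0 < A)
    (hg : lorentzNorm (ENNReal.ofReal p) ∞ (fracLap ((n:ℝ)/2) f) ≤ ENNReal.ofReal A)
    {T h σ : ℝ} (hT : 0 < T) (hh : 0 < h) (hσ : 0 < σ) {S : Set (Eucl n)}
    (hSσ : volume S = ENNReal.ofReal σ) :
    ∫⁻ x in S, ENNReal.ofReal |f x| ≤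
      ENNReal.ofReal (K1 n * (h * σ * T ^ ((n:ℝ)/4)) +
        K2 n p * (A ^ p * h ^ (1 - p) * σ ^ (1/4 : ℝ) * T ^ ((n:ℝ)/8))) +
      ENNReal.ofReal (C2 n * T ^ (-(n : ℝ) / 2)) * (∫⁻ y, ENNReal.ofReal |f y|) * ENNReal.ofReal σ := by
  have hn' : (0 : ℝ) < n := by exact_mod_cast hn
  have hp1 : 0 < p - 1 := by linarith
  have hΓ : 0 < Real.Gamma ((n:ℝ)/4) := Real.Gamma_pos_of_pos (by positivity)
  have hgm : Measurable (fracLap ((n:ℝ)/2) f) := (fracLap_continuous (by positivity) hf hc).measurable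
  set g := fracLap ((n:ℝ)/2) f with hgdef
  set Γ := Real.Gamma ((n:ℝ)/4) with hΓdef
  have hmeas : Measurable (fun z : Eucl n × ℝ => ENNReal.ofReal (z.2 ^ ((n : ℝ) / 4 - 1) / Γ) *
        ∫⁻ y, ENNReal.ofReal |g y| * ENNReal.ofReal (hk n z.2 (z.1 - y))) := by
    apply Measurable.mul (by fun_prop)
    have : Measurable (fun w : (Eucl n × ℝ) × Eucl n =>
        ENNReal.ofReal |g w.2| * ENNReal.ofReal (hk n w.1.2 (w.1.1 - w.2))) := by
      unfold hk; fun_prop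
    exact this.lintegral_prod_right'
  calc ∫⁻ x in S, ENNReal.ofReal |f x|
      ≤ ∫⁻ x in S, ((∫⁻ t in Ioc 0 T, ENNReal.ofReal (t ^ ((n : ℝ) / 4 - 1) / Γ) *
        ∫⁻ y, ENNReal.ofReal |g y| * ENNReal.ofReal (hk n t (x - y)))
      + ENNReal.ofReal (C2 n * T ^ (-(n : ℝ) / 2)) * ∫⁻ y, ENNReal.ofReal |f y|) :=
        lintegral_mono fun x => rep n hn hf hc hT x
    _ = (∫⁻ t in Ioc 0 T, ENNReal.ofReal (t ^ ((n : ℝ) / 4 - 1) / Γ) *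
        ∫⁻ x in S, ∫⁻ y, ENNReal.ofReal |g y| * ENNReal.ofReal (hk n t (x - y)))
      + ENNReal.ofReal (C2 n * T ^ (-(n : ℝ) / 2)) * (∫⁻ y, ENNReal.ofReal |f y|) * ENNReal.ofReal σ := by
        rw [lintegral_add_right _ measurable_const, setLIntegral_const, hSσ,
          lintegral_lintegral_swap hmeas.aemeasurable]
        congr 2 with t
        rw [lintegral_const_mul]
        have : Measurable (fun w : Eucl n × Eucl n =>
          ENNReal.ofReal |g w.2| * ENNReal.ofReal (hk n t (w.1 - w.2))) := by
          unfold hk; fun_prop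
        exact this.lintegral_prod_right'
    _ ≤ (∫⁻ t in Ioc 0 T, (ENNReal.ofReal (h * σ / Γ) * ENNReal.ofReal (t ^ ((n : ℝ) / 4 - 1)) +
          ENNReal.ofReal (A ^ p * h ^ (1 - p) / (p - 1) * σ ^ (1/4 : ℝ) * (π / (4 * π ^ 2)) ^ ((n:ℝ)/8) / Γ)
            * ENNReal.ofReal (t ^ ((n:ℝ)/8 - 1))))
      + ENNReal.ofReal (C2 n * T ^ (-(n : ℝ) / 2)) * (∫⁻ y, ENNReal.ofReal |f y|) * ENNReal.ofReal σ := by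
        refine add_le_add (setLIntegral_mono' measurableSet_Ioc fun t ht => ?_) le_rfl
        have ht0 : 0 < t := ht.1
        have h1 := heat_est hgm (S := S) (h := h) ht0
        have h2 := trunc_bound hp hgm hA hg hh
        rw [hSσ] at h1
        have e1 : (ENNReal.ofReal σ * ENNReal.ofReal ((π / (4 * π ^ 2 * t)) ^ ((n : ℝ) / 2))) ^ (1/4 : ℝ)
            = ENNReal.ofReal (σ ^ (1/4 : ℝ) * ((π / (4 * π ^ 2)) ^ ((n:ℝ)/8) * t ^ (-((n:ℝ)/8)))) := by
          rw [← ENNReal.ofReal_mul hσ.le, ENNReal.ofReal_rpow_of_pos (by positivity)]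
          congr 1
          rw [Real.mul_rpow hσ.le (by positivity), ← Real.rpow_mul (by positivity),
            ← div_div π (4 * π ^ 2) t, Real.div_rpow (by positivity) ht0.le, Real.rpow_neg ht0.le,
            show (n:ℝ)/2 * (1/4) = (n:ℝ)/8 by ring]
          ring
        rw [e1] at h1
        have e2 : t ^ ((n:ℝ)/4 - 1) * t ^ (-((n:ℝ)/8)) = t ^ ((n:ℝ)/8 - 1) := by
          rw [← Real.rpow_add ht0]; congr 1; ring
        calc _ ≤ ENNReal.ofReal (t ^ ((n : ℝ) / 4 - 1) / Γ) * (ENNReal.ofReal h * ENNReal.ofReal σ +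
              ENNReal.ofReal (A ^ p * h ^ (1 - p) / (p - 1)) *
              ENNReal.ofReal (σ ^ (1/4 : ℝ) * ((π / (4 * π ^ 2)) ^ ((n:ℝ)/8) * t ^ (-((n:ℝ)/8))))) := by
              refine mul_le_mul' le_rfl (h1.trans ?_)
              exact add_le_add le_rfl (mul_le_mul' h2 le_rfl)
          _ = _ := by
              rw [mul_add]
              congr 1
              · rw [← ENNReal.ofReal_mul hh.le, ← ENNReal.ofReal_mul (by positivity),
                  ← ENNReal.ofReal_mul (by positivity)]
                congr 1; ring
              · rw [← ENNReal.ofReal_mul (by positivity), ← ENNReal.ofReal_mul (by positivity),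
                  ← ENNReal.ofReal_mul (by positivity), ← e2]
                congr 1; ring
    _ = _ := by
        congr 1
        rw [lintegral_add_left (by fun_prop), lintegral_const_mul _ (by fun_prop),
          lintegral_const_mul _ (by fun_prop), rpow_lint (by positivity) hT, rpow_lint (by positivity) hT,
          ← ENNReal.ofReal_mul (by positivity), ← ENNReal.ofReal_mul (by positivity),
          ← ENNReal.ofReal_add (by positivity) (by positivity)]
        congr 1
        simp only [K1, K2]
        rw [← hΓdef]
        field_simp

lemma lor_final {n : ℕ} {p : ℝ} (hp : 1 < p) {q : ℝ≥0∞} (hq : 1 ≤ q) {D V : ℝ} (hD : 0 < D) (hV : 0 < V)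
    {f : Eucl n → ℝ} (h1 : ∀ t : ℝ, 0 < t → decRear f t ≤ ENNReal.ofReal (D * t ^ (-(3 / (4 * p)))))
    (h2 : ∀ t : ℝ, V ≤ t → decRear f t = 0) :
    lorentzNorm (ENNReal.ofReal p) q f ≤
      ENNReal.ofReal ((if q = ∞ then 1 else (4 * p / q.toReal) ^ (1 / q.toReal)) * (D * V ^ (1 / (4 * p)))) := by
  have hp0 : 0 < p := by linarith
  have e : (1 / ENNReal.ofReal p).toReal = 1 / p := by
    rw [ENNReal.toReal_div, ENNReal.toReal_ofReal hp0.le]; simp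
  have hb : ∀ t : ℝ, 0 < t → ENNReal.ofReal (t ^ (1 / p)) * decRear f t ≤
      ENNReal.ofReal (D * t ^ (1 / (4 * p))) := by
    intro t ht
    refine (mul_le_mul' le_rfl (h1 t ht)).trans ?_
    rw [← ENNReal.ofReal_mul (by positivity)]
    apply ENNReal.ofReal_le_ofReal
    rw [mul_left_comm, ← Real.rpow_add ht]
    apply le_of_eq
    congr 2
    field_simp
    norm_num
  by_cases hqt : q = ∞
  · rw [lorentzNorm, if_pos hqt, if_neg ENNReal.ofReal_ne_top, if_pos hqt, e, one_mul]
    refine iSup_le fun ⟨t, ht⟩ => ?_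
    rcases le_total V t with h | h
    · simp [h2 t h]
    · refine (hb t ht).trans (ENNReal.ofReal_le_ofReal ?_)
      gcongr
  · rw [lorentzNorm, if_neg hqt, if_neg hqt, e]
    set Q := q.toReal with hQ
    have hQ1 : 0 < Q := ENNReal.toReal_pos (by
      intro h; rw [h] at hq; simp at hq) hqt
    set b := Q / (4 * p) with hbdef
    have hb0 : 0 < b := by positivity
    have key : ∫⁻ t in Ioi (0:ℝ), (ENNReal.ofReal (t ^ (1 / p)) * decRear f t) ^ Q / ENNReal.ofReal t ≤
        ENNReal.ofReal (D ^ Q) * ENNReal.ofReal (V ^ b / b) := by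
      rw [← rpow_lint hb0 hV, ← lintegral_const_mul _ (by fun_prop),
        ← Ioc_union_Ioi_eq_Ioi hV.le]
      refine (lintegral_union_le _ _ _).trans ?_
      have z : ∫⁻ t in Ioi V, (ENNReal.ofReal (t ^ (1 / p)) * decRear f t) ^ Q / ENNReal.ofReal t = 0 := by
        rw [setLIntegral_congr_fun (g := fun _ => 0) measurableSet_Ioi]
        · simp
        · intro t ht
          have ht' : V < t := ht
          simp [h2 t ht'.le, hQ1]
      rw [z, add_zero]
      refine setLIntegral_mono' measurableSet_Ioc fun t ht => ?_
      have ht0 : 0 < t := ht.1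
      calc (ENNReal.ofReal (t ^ (1 / p)) * decRear f t) ^ Q / ENNReal.ofReal t
          ≤ (ENNReal.ofReal (D * t ^ (1 / (4 * p)))) ^ Q / ENNReal.ofReal t := by
            gcongr
            exact hb t ht0
        _ = _ := by
            rw [ENNReal.ofReal_rpow_of_pos (by positivity), ← ENNReal.ofReal_div_of_pos ht0,
              ← ENNReal.ofReal_mul (by positivity)]
            congr 1
            rw [Real.mul_rpow hD.le (by positivity), ← Real.rpow_mul ht0.le, Real.rpow_sub_one ht0.ne',
              mul_div_assoc, hbdef]
            congr 3
            ring
    calc _ ≤ (ENNReal.ofReal (D ^ Q) * ENNReal.ofReal (V ^ b / b)) ^ (1 / Q) := by gcongr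
      _ = _ := by
        rw [← ENNReal.ofReal_mul (by positivity), ENNReal.ofReal_rpow_of_pos (by positivity)]
        congr 1
        rw [Real.mul_rpow (by positivity) (by positivity), ← Real.rpow_mul hD.le, mul_one_div_cancel hQ1.ne',
          Real.rpow_one, div_eq_mul_inv, Real.mul_rpow (by positivity) (by positivity), ← Real.rpow_mul hV.le,
          hbdef, inv_div]
        have : Q / (4 * p) * (1 / Q) = 1 / (4 * p) := by field_simp
        rw [this]
        ring

def C3 (n : ℕ) (p : ℝ) : ℝ := K1 n * (2 * C2 n) ^ (1/2 : ℝ) + K2 n p * (2 * C2 n) ^ (1/4 : ℝ)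

lemma C2_pos (n : ℕ) : 0 < C2 n := by unfold C2; positivity

lemma C3_pos {n : ℕ} (hn : 1 ≤ n) {p : ℝ} (hp : 1 < p) : 0 < C3 n p := by
  have hn' : (0 : ℝ) < n := by exact_mod_cast hn
  have hp1 : 0 < p - 1 := by linarith
  have hΓ : 0 < Real.Gamma ((n:ℝ)/4) := Real.Gamma_pos_of_pos (by positivity)
  have := C2_pos n
  unfold C3 K1 K2; positivity

lemma S_est2 {n : ℕ} (hn : 1 ≤ n) {p : ℝ} (hp : 1 < p) {f : Eucl n → ℝ} (hf : ContDiff ℝ (⊤ : ℕ∞) f)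
    (hc : HasCompactSupport f) {A : ℝ} (hA : 0 < A)
    (hg : lorentzNorm (ENNReal.ofReal p) ∞ (fracLap ((n:ℝ)/2) f) ≤ ENNReal.ofReal A)
    {V σ : ℝ} (hV : 0 < V) (hσ : 0 < σ) {S : Set (Eucl n)}
    (hSσ : volume S = ENNReal.ofReal σ) :
    ∫⁻ x in S, ENNReal.ofReal |f x| ≤
      ENNReal.ofReal (C3 n p * A * V ^ (1/2 - 1/(4*p)) * σ ^ (1 - 3/(4*p))) +
      ENNReal.ofReal (σ / (2 * V)) * (∫⁻ y, ENNReal.ofReal |f y|) := by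
  have hn' : (0 : ℝ) < n := by exact_mod_cast hn
  have hp0 : 0 < p := by linarith
  have hC2 := C2_pos n
  set W := 2 * C2 n * V with hW
  have hW0 : 0 < W := by positivity
  have hTr : ∀ s : ℝ, (W ^ (2 / (n:ℝ))) ^ s = W ^ (2 / (n:ℝ) * s) := fun s => (Real.rpow_mul hW0.le _ _).symm
  have hh : 0 < A * V ^ (-(1/(4*p))) * σ ^ (-(3/(4*p))) := by positivity
  have key := S_est hn hp hf hc hA hg (T := W ^ (2 / (n:ℝ)))
    (h := A * V ^ (-(1/(4*p))) * σ ^ (-(3/(4*p)))) (by positivity) hh hσ hSσ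
  refine key.trans (le_of_eq ?_)
  rw [hTr, hTr, hTr]
  have t1 : 2 / (n:ℝ) * (n/4) = 1/2 := by field_simp; norm_num
  have t2 : 2 / (n:ℝ) * (n/8) = 1/4 := by field_simp; norm_num
  have t3 : 2 / (n:ℝ) * (-n/2) = -1 := by field_simp
  rw [t1, t2, t3]
  have w1 : W ^ (1/2:ℝ) = (2 * C2 n) ^ (1/2:ℝ) * V ^ (1/2:ℝ) := Real.mul_rpow (by positivity) hV.le
  have w2 : W ^ (1/4:ℝ) = (2 * C2 n) ^ (1/4:ℝ) * V ^ (1/4:ℝ) := Real.mul_rpow (by positivity) hV.le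
  have hpow : A ^ p * (A * V ^ (-(1/(4*p))) * σ ^ (-(3/(4*p)))) ^ (1 - p) =
      A * V ^ (1/4 - 1/(4*p)) * σ ^ (3/4 - 3/(4*p)) := by
    rw [Real.mul_rpow (by positivity) (by positivity), Real.mul_rpow hA.le (by positivity),
      ← Real.rpow_mul hV.le, ← Real.rpow_mul hσ.le, ← mul_assoc, ← mul_assoc, ← Real.rpow_add hA]
    rw [show p + (1 - p) = 1 by ring, Real.rpow_one]
    congr 3
    · field_simp; ring
    · field_simp; ring
  congr 1
  · congr 1
    rw [hpow, w1, w2]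
    have v1 : V ^ (-(1/(4*p))) * V ^ (1/2:ℝ) = V ^ (1/2 - 1/(4*p)) := by
      rw [← Real.rpow_add hV]; congr 1; ring
    have v2 : V ^ (1/4 - 1/(4*p)) * V ^ (1/4:ℝ) = V ^ (1/2 - 1/(4*p)) := by
      rw [← Real.rpow_add hV]; congr 1; ring
    have s1 : σ ^ (-(3/(4*p))) * σ = σ ^ (1 - 3/(4*p)) := by
      rw [← Real.rpow_add_one hσ.ne']; congr 1; ring
    have s2 : σ ^ (3/4 - 3/(4*p)) * σ ^ (1/4:ℝ) = σ ^ (1 - 3/(4*p)) := by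
      rw [← Real.rpow_add hσ]; congr 1; ring
    unfold C3
    calc _ = K1 n * (2 * C2 n) ^ (1/2 : ℝ) * A * (V ^ (-(1/(4*p))) * V ^ (1/2:ℝ)) * (σ ^ (-(3/(4*p))) * σ)
          + K2 n p * (2 * C2 n) ^ (1/4 : ℝ) * A * (V ^ (1/4 - 1/(4*p)) * V ^ (1/4:ℝ)) *
            (σ ^ (3/4 - 3/(4*p)) * σ ^ (1/4:ℝ)) := by ring
      _ = _ := by rw [v1, v2, s1, s2]; ring
  · rw [mul_right_comm, ← ENNReal.ofReal_mul (by positivity)]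
    congr 2
    rw [Real.rpow_neg_one, hW]
    field_simp

lemma decRear_est {n : ℕ} (hn : 1 ≤ n) {p : ℝ} (hp : 1 < p) {f : Eucl n → ℝ} (hf : ContDiff ℝ (⊤ : ℕ∞) f)
    (hc : HasCompactSupport f) {A : ℝ} (hA : 0 < A)
    (hg : lorentzNorm (ENNReal.ofReal p) ∞ (fracLap ((n:ℝ)/2) f) ≤ ENNReal.ofReal A)
    {V : ℝ} (hV : 0 < V) {B : Set (Eucl n)} (hBm : MeasurableSet B) (hB : volume B = ENNReal.ofReal V)
    (hfB : ∀ x, x ∉ B → f x = 0) :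
    (∀ t : ℝ, 0 < t → decRear f t ≤
      ENNReal.ofReal ((2 * C3 n p * A * V ^ (1/2 - 1/(4*p))) * t ^ (-(3 / (4 * p))))) ∧
    (∀ t : ℝ, V ≤ t → decRear f t = 0) := by
  have hp0 : 0 < p := by linarith
  have hC3 := C3_pos hn hp
  have hfi : Integrable f := hf.continuous.integrable_of_hasCompactSupport hc
  set F : ℝ := ∫ x, |f x| with hF
  have hFe : ∫⁻ x, ENNReal.ofReal |f x| = ENNReal.ofReal F :=
    (ofReal_integral_eq_lintegral_ofReal hfi.abs (Filter.Eventually.of_forall fun x => abs_nonneg _)).symm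
  have hF0 : 0 ≤ F := integral_nonneg fun x => abs_nonneg _
  have hb3 : 0 < 3 / (4 * p) := by positivity
  have hFB : F ≤ 2 * C3 n p * A * V ^ (3/2 - 1/p) := by
    have h := S_est2 hn hp hf hc hA hg hV hV hB
    rw [← lintegral_indicator hBm] at h
    have e : ∀ x, B.indicator (fun x => ENNReal.ofReal |f x|) x = ENNReal.ofReal |f x| := by
      intro x
      by_cases hx : x ∈ B
      · simp [hx]
      · simp [hx, hfB x hx]
    simp_rw [e] at h
    rw [hFe, ← ENNReal.ofReal_mul (by positivity), ← ENNReal.ofReal_add (by positivity) (by positivity),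
      ENNReal.ofReal_le_ofReal_iff (by positivity)] at h
    have e1 : V / (2 * V) = 1/2 := by field_simp
    have e2 : V ^ (1/2 - 1/(4*p)) * V ^ (1 - 3/(4*p)) = V ^ (3/2 - 1/p) := by
      rw [← Real.rpow_add hV]; congr 1; field_simp; ring
    rw [e1, mul_assoc _ (V ^ (1/2 - 1/(4*p))), e2] at h
    linarith
  set D := 2 * C3 n p * A * V ^ (1/2 - 1/(4*p)) with hD
  have hD0 : 0 < D := by positivity
  constructor
  · intro t ht
    set l := D * t ^ (-(3 / (4 * p))) with hl
    have hl0 : 0 < l := by positivity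
    have hvol : volume {x : Eucl n | l < |f x|} ≤ ENNReal.ofReal t := by
      by_contra hcon
      push Not at hcon
      set S := {x : Eucl n | l < |f x|} with hSdef
      have hSB : S ⊆ B := by
        intro x hx
        by_contra hxB
        have : l < |f x| := hx
        rw [hfB x hxB, abs_zero] at this
        linarith
      have hle : volume S ≤ ENNReal.ofReal V := hB ▸ measure_mono hSB
      have hfin : volume S ≠ ∞ := (hle.trans_lt ENNReal.ofReal_lt_top).ne
      set σ := (volume S).toReal with hσdef
      have hSσ : volume S = ENNReal.ofReal σ := (ENNReal.ofReal_toReal hfin).symm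
      rw [hSσ] at hcon hle
      have htσ : t < σ := by
        rwa [ENNReal.ofReal_lt_ofReal_iff_of_nonneg ht.le] at hcon
      have hσ0 : 0 < σ := ht.trans htσ
      have hσV : σ ≤ V := (ENNReal.ofReal_le_ofReal_iff hV.le).1 hle
      have hSm : MeasurableSet S := measurableSet_lt measurable_const (by
        exact hf.continuous.abs.measurable)
      have h := S_est2 hn hp hf hc hA hg hV hσ0 hSσ
      have hlow : ENNReal.ofReal (l * σ) ≤ ∫⁻ x in S, ENNReal.ofReal |f x| := by
        rw [ENNReal.ofReal_mul hl0.le, ← hSσ, ← setLIntegral_const]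
        refine setLIntegral_mono' hSm fun x hx => ENNReal.ofReal_le_ofReal ?_
        exact le_of_lt hx
      have h := hlow.trans h
      rw [hFe, ← ENNReal.ofReal_mul (by positivity), ← ENNReal.ofReal_add (by positivity) (by positivity),
      ENNReal.ofReal_le_ofReal_iff (by positivity)] at h
      have i1 : σ / (2 * V) * F ≤ C3 n p * A * (V ^ (1/2 - 1/(4*p)) * σ ^ (1 - 3/(4*p))) := by
        calc σ / (2 * V) * F ≤ σ / (2 * V) * (2 * C3 n p * A * V ^ (3/2 - 1/p)) := by gcongr
          _ = C3 n p * A * (σ ^ (1 - 3/(4*p)) * σ ^ (3/(4*p)) * V ^ (1/2 - 1/p)) := by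
              rw [← Real.rpow_add hσ0, sub_add_cancel, Real.rpow_one]
              have : V ^ (3/2 - 1/p) = V ^ (1/2 - 1/p) * V := by
                rw [← Real.rpow_add_one hV.ne']; congr 1; ring
              rw [this]; field_simp
          _ ≤ C3 n p * A * (σ ^ (1 - 3/(4*p)) * V ^ (3/(4*p)) * V ^ (1/2 - 1/p)) := by gcongr
          _ = _ := by
              rw [mul_assoc (σ ^ (1 - 3/(4*p))), ← Real.rpow_add hV, mul_comm (σ ^ (1 - 3/(4*p)))]
              congr 3
              field_simp; ring
      have i2 : l * σ ≤ D * σ ^ (1 - 3/(4*p)) := by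
        rw [hD]; linarith
      have e3 : σ ^ (1 - 3/(4*p)) = σ ^ (-(3/(4*p))) * σ := by
        rw [← Real.rpow_add_one hσ0.ne']; congr 1; ring
      rw [e3, ← mul_assoc] at i2
      have i3 := le_of_mul_le_mul_right i2 hσ0
      rw [hl] at i3
      have i4 := le_of_mul_le_mul_left i3 hD0
      have i5 := Real.rpow_lt_rpow_of_neg ht htσ (neg_lt_zero.2 hb3)
      linarith
    unfold decRear
    refine (iInf₂_le (⟨l, hl0.le⟩ : ℝ≥0) hvol).trans (le_of_eq ?_)
    rw [ENNReal.ofReal, Real.toNNReal_of_nonneg hl0.le]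
    rfl
  · intro t ht
    unfold decRear
    apply le_antisymm _ zero_le
    refine (iInf₂_le (0 : ℝ≥0) ?_).trans (by simp)
    refine le_trans (measure_mono (t := B) ?_) (hB.trans_le (ENNReal.ofReal_le_ofReal ht))
    intro x hx
    by_contra hxB
    have : ((0:ℝ≥0):ℝ) < |f x| := hx
    simp [hfB x hxB] at this

/-- Poincaré inequality for the fractional Laplacian `Δ^{n/4}`. -/
theorem statement_9 (n : ℕ) (hn : 1 ≤ n) (p : ℝ) (hp : 1 < p) (q : ℝ≥0∞) (hq : 1 ≤ q) :
    ∃ C > (0:ℝ), ∀ (x : Eucl n) (r : ℝ), 0 < r → ∀ f : Eucl n → ℝ,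
      IsTestFn (ball x r) f →
      lorentzNorm (ENNReal.ofReal p) q f ≤
        ENNReal.ofReal (C * r ^ ((n:ℝ)/2)) *
          lorentzNorm (ENNReal.ofReal p) ∞ (fracLap ((n:ℝ)/2) f) := by
  have hp0 : 0 < p := by linarith
  have hC3 := C3_pos hn hp
  set v : ℝ := (volume (ball (0 : Eucl n) 1)).toReal with hv
  have hv0 : 0 < v := ENNReal.toReal_pos (measure_ball_pos _ _ one_pos).ne' measure_ball_lt_top.ne
  set cq : ℝ := (if q = ∞ then 1 else (4 * p / q.toReal) ^ (1 / q.toReal)) with hcq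
  have hcq0 : 0 < cq := by
    rw [hcq]
    split_ifs with h
    · exact one_pos
    · have : 0 < q.toReal := ENNReal.toReal_pos (by
        intro h; rw [h] at hq; simp at hq) h
      positivity
  refine ⟨cq * (2 * C3 n p) * v ^ (1/2 : ℝ), by positivity, ?_⟩
  intro x r hr f hf
  obtain ⟨hf1, hf2, hf3⟩ := hf
  have hV : 0 < r ^ n * v := by positivity
  have hB : volume (ball x r) = ENNReal.ofReal (r ^ n * v) := by
    rw [Measure.addHaar_ball_of_pos _ _ hr, ENNReal.ofReal_mul (by positivity), hv,
      ENNReal.ofReal_toReal measure_ball_lt_top.ne]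
    simp
  have main : ∀ A : ℝ, 0 < A →
      lorentzNorm (ENNReal.ofReal p) ∞ (fracLap ((n:ℝ)/2) f) ≤ ENNReal.ofReal A →
      lorentzNorm (ENNReal.ofReal p) q f ≤
        ENNReal.ofReal (cq * (2 * C3 n p) * v ^ (1/2 : ℝ) * r ^ ((n:ℝ)/2)) * ENNReal.ofReal A := by
    intro A hA hg
    obtain ⟨d1, d2⟩ := decRear_est hn hp hf1 hf2 hA hg hV measurableSet_ball hB (by
      intro y hy
      exact image_eq_zero_of_notMem_tsupport fun h => hy (hf3 h))
    refine (lor_final hp hq (by positivity) hV d1 d2).trans (le_of_eq ?_)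
    rw [← ENNReal.ofReal_mul (by positivity), ← hcq]
    congr 1
    have e1 : (r ^ n * v) ^ (1/2 - 1/(4*p)) * (r ^ n * v) ^ (1/(4*p)) = v ^ (1/2 : ℝ) * r ^ ((n:ℝ)/2) := by
      rw [← Real.rpow_add hV, sub_add_cancel, Real.mul_rpow (by positivity) hv0.le, ← Real.rpow_natCast,
        ← Real.rpow_mul hr.le, mul_one_div, mul_comm]
    linear_combination (cq * (2 * C3 n p) * A) * e1
  set N := lorentzNorm (ENNReal.ofReal p) ∞ (fracLap ((n:ℝ)/2) f) with hN
  have hc0 : 0 < cq * (2 * C3 n p) * v ^ (1/2 : ℝ) * r ^ ((n:ℝ)/2) := by positivity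
  by_cases hNt : N = ∞
  · rw [hNt, ENNReal.mul_top (by simpa using hc0)]
    exact le_top
  · apply ENNReal.le_of_forall_pos_le_add
    intro ε hε _
    have hε' : (0:ℝ) < ε := hε
    set c := cq * (2 * C3 n p) * v ^ (1/2 : ℝ) * r ^ ((n:ℝ)/2) with hc
    have hNn : 0 ≤ N.toReal := ENNReal.toReal_nonneg
    refine (main (N.toReal + ε / c) (by positivity) ?_).trans (le_of_eq ?_)
    · rw [ENNReal.ofReal_add hNn (by positivity), ENNReal.ofReal_toReal hNt]
      exact le_self_add
    · rw [ENNReal.ofReal_add hNn (by positivity), ENNReal.ofReal_toReal hNt, mul_add,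
        ← ENNReal.ofReal_mul hc0.le, mul_div_cancel₀ _ hc0.ne', ENNReal.ofReal_coe_nnreal]
end
end

section
/- Let s ≥ 0 and f be a Schwartz function on ℝⁿ. Then Δ^{s/2} f ∈ L^{p,q}(ℝⁿ) for all p ∈ (1,∞), q ∈ [1,∞], as well as for (p,q) = (1,1) and (p,q) = (∞,∞). Moreover, for the rescaled cutoff functions one has the scaling estimate ‖Δ^{s/2} η_r^k‖_{(p,q),ℝⁿ} ≤ C_{p,q} (2^k r)^{n/p − s}. -/
open MeasureTheory Real FourierTransform Metric Set Matrix
open scoped ENNReal Topology NNReal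

noncomputable section

namespace FL10

open SchwartzMap Filter

variable {n : ℕ}

/-- The `L¹` norm of the inverse Fourier transform of a Schwartz function. -/
noncomputable def nrm (g : 𝓢(Eucl n, ℂ)) : ℝ≥0∞ := ∫⁻ x, ‖(𝓕⁻ g) x‖ₑ

lemma nrm_lt_top (g : 𝓢(Eucl n, ℂ)) : nrm g < ⊤ :=
  (SchwartzMap.integrable (𝓕⁻ g)).2

lemma nrm_add (f g : 𝓢(Eucl n, ℂ)) : nrm (f + g) ≤ nrm f + nrm g := by
  unfold nrm
  rw [FourierTransform.fourierInv_add, ← lintegral_add_left]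
  · exact lintegral_mono fun x => enorm_add_le _ _
  · exact (𝓕⁻ f).continuous.enorm.measurable

lemma nrm_sum {ι : Type*} (t : Finset ι) (f : ι → 𝓢(Eucl n, ℂ)) :
    nrm (∑ i ∈ t, f i) ≤ ∑ i ∈ t, nrm (f i) := by
  classical
  induction t using Finset.induction_on with
  | empty => simp [nrm, FourierTransform.fourierInv_zero]
  | insert a t ha ih =>
    rw [Finset.sum_insert ha, Finset.sum_insert ha]
    exact (nrm_add _ _).trans (by gcongr)

lemma nrm_smul (c : ℝ) (hc : 0 ≤ c) (f : 𝓢(Eucl n, ℂ)) :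
    nrm ((c : ℂ) • f) = ENNReal.ofReal c * nrm f := by
  unfold nrm
  rw [FourierTransform.fourierInv_smul, ← lintegral_const_mul]
  · refine lintegral_congr fun x => ?_
    rw [_root_.smul_apply, enorm_smul]
    congr 1
    rw [← ofReal_norm]
    simp [abs_of_nonneg hc]
  · exact (𝓕⁻ f).continuous.enorm.measurable

open Convolution in
lemma nrm_mul (a b : 𝓢(Eucl n, ℂ)) :
    nrm (pairing (ContinuousLinearMap.mul ℂ ℂ) a b) ≤ nrm a * nrm b := by
  have h : 𝓕⁻ (pairing (ContinuousLinearMap.mul ℂ ℂ) a b) =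
      SchwartzMap.convolution (ContinuousLinearMap.mul ℂ ℂ) (𝓕⁻ a) (𝓕⁻ b) := by
    have := fourier_convolution (ContinuousLinearMap.mul ℂ ℂ) (𝓕⁻ a) (𝓕⁻ b)
    rw [FourierTransform.fourier_fourierInv_eq, FourierTransform.fourier_fourierInv_eq] at this
    rw [← this, FourierTransform.fourierInv_fourier_eq]
  unfold nrm
  rw [h]
  set A := 𝓕⁻ a
  set B := 𝓕⁻ b
  have hA : Measurable fun x => ‖A x‖ₑ := A.continuous.enorm.measurable
  have hB : Measurable fun x => ‖B x‖ₑ := B.continuous.enorm.measurable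
  calc ∫⁻ x, ‖SchwartzMap.convolution (ContinuousLinearMap.mul ℂ ℂ) A B x‖ₑ
      ≤ ∫⁻ x, ∫⁻ t, ‖A t‖ₑ * ‖B (x - t)‖ₑ := by
        refine lintegral_mono fun x => ?_
        rw [convolution_apply, MeasureTheory.convolution]
        refine (enorm_integral_le_lintegral_enorm _).trans (lintegral_mono fun t => ?_)
        simp [enorm_mul]
    _ = ∫⁻ t, ∫⁻ x, ‖A t‖ₑ * ‖B (x - t)‖ₑ := by
        refine lintegral_lintegral_swap ?_
        refine Measurable.aemeasurable ?_
        refine (hA.comp measurable_snd).mul (hB.comp (measurable_fst.sub measurable_snd))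
    _ = ∫⁻ t, ‖A t‖ₑ * ∫⁻ x, ‖B x‖ₑ := by
        refine lintegral_congr fun t => ?_
        rw [lintegral_const_mul _ (show Measurable fun x => ‖B (x - t)‖ₑ from
          hB.comp (measurable_id.sub_const t))]
        congr 1
        exact lintegral_sub_right_eq_self (fun x => ‖B x‖ₑ) t
    _ = _ := by rw [lintegral_mul_const _ hA]

lemma finrank_eucl : Module.finrank ℝ (Eucl n) = n := by simp

lemma fourierInv_dil (h : Eucl n → ℂ) (c : ℝ) (hc : 0 < c) (x : Eucl n) :
    𝓕⁻ (fun ξ => h (c • ξ)) x = ((c ^ n)⁻¹ : ℝ) • 𝓕⁻ h (c⁻¹ • x) := by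
  rw [Real.fourierInv_eq, Real.fourierInv_eq]
  have := Measure.integral_comp_smul_of_nonneg volume
    (fun v : Eucl n => 𝐞 (inner ℝ v (c⁻¹ • x)) • h v) c (hR := hc.le)
  rw [finrank_eucl] at this
  rw [← this]
  congr 1
  ext v
  rw [inner_smul_left, inner_smul_right]
  simp [mul_inv_cancel_left₀ hc.ne']

lemma lintegral_dil (g : Eucl n → ℝ≥0∞) (hg : Measurable g) (c : ℝ) (hc : 0 < c) :
    ∫⁻ x, g (c • x) = ENNReal.ofReal ((c ^ n)⁻¹) * ∫⁻ x, g x := by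
  have h := Measure.map_addHaar_smul (volume : Measure (Eucl n)) hc.ne'
  rw [finrank_eucl, abs_of_pos (by positivity)] at h
  rw [← lintegral_map (f := g) (g := fun x : Eucl n => c • x) hg (measurable_const_smul c)]
  rw [h, lintegral_smul_measure, smul_eq_mul]

lemma nrm_dil (g G : 𝓢(Eucl n, ℂ)) (c : ℝ) (hc : 0 < c) (h : ∀ ξ, G ξ = g (c • ξ)) :
    nrm G = nrm g := by
  unfold nrm
  have : ∀ x, (𝓕⁻ G) x = ((c ^ n)⁻¹ : ℝ) • (𝓕⁻ g) (c⁻¹ • x) := by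
    intro x
    rw [SchwartzMap.fourierInv_coe, SchwartzMap.fourierInv_coe, ← fourierInv_dil _ _ hc]
    exact congrArg (fun F : Eucl n → ℂ => 𝓕⁻ F x) (funext h)
  simp_rw [this]
  have hg : Measurable fun x => ‖(𝓕⁻ g) x‖ₑ := (𝓕⁻ g).continuous.enorm.measurable
  simp_rw [enorm_smul]
  rw [lintegral_const_mul _ (show Measurable fun x : Eucl n => ‖(𝓕⁻ g : 𝓢(Eucl n, ℂ)) (c⁻¹ • x)‖ₑ from
      hg.comp (measurable_const_smul _))]
  have hd := lintegral_dil (fun x : Eucl n => ‖(𝓕⁻ g : 𝓢(Eucl n, ℂ)) x‖ₑ) hg _ (inv_pos.2 hc)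
  beta_reduce at hd
  rw [hd, ← mul_assoc]
  rw [← ofReal_norm, ← ENNReal.ofReal_mul (norm_nonneg _)]
  have hcn : c ^ n ≠ 0 := by positivity
  simp [abs_of_pos hc, hcn]

end FL10

namespace FL10

open SchwartzMap Filter

variable {n : ℕ}

/-- The smooth radial cutoff: one on the unit ball, supported in the ball of radius two. -/
noncomputable def bump (n : ℕ) : ContDiffBump (0 : Eucl n) := ⟨1, 2, one_pos, one_lt_two⟩

lemma bump_one {x : Eucl n} (h : ‖x‖ ≤ 1) : bump n x = 1 :=
  (bump n).one_of_mem_closedBall (by simpa [bump] using h)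

lemma bump_zero {x : Eucl n} (h : 2 ≤ ‖x‖) : bump n x = 0 :=
  (bump n).zero_of_le_dist (by simpa [bump] using h)

/-- `|2πξ|^a` localized to a dyadic annulus. -/
noncomputable def chiR (a : ℝ) (ξ : Eucl n) : ℝ :=
  (2 * π * ‖ξ‖) ^ a * (bump n ξ - bump n ((2 : ℝ) • ξ))

lemma chiR_contDiff (a : ℝ) : ContDiff ℝ (⊤ : ℕ∞) (chiR (n := n) a) := by
  rw [contDiff_iff_contDiffAt]
  intro ξ
  by_cases h : ξ = 0
  · subst h
    refine (contDiffAt_const (c := (0 : ℝ))).congr_of_eventuallyEq ?_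
    filter_upwards [Metric.ball_mem_nhds (0 : Eucl n) (show (0 : ℝ) < 1 / 2 by norm_num)] with x hx
    rw [mem_ball_zero_iff] at hx
    unfold chiR
    rw [bump_one (by linarith), bump_one (by rw [norm_smul]; norm_num; linarith)]
    simp
  · unfold chiR
    have h1 : ContDiffAt ℝ (⊤ : ℕ∞) (fun ξ : Eucl n => (2 * π * ‖ξ‖)) ξ :=
      contDiffAt_const.mul (contDiffAt_norm ℝ h)
    have h2 : (2 * π * ‖ξ‖) ≠ 0 := by
      have := norm_pos_iff.2 h
      positivity
    refine (h1.rpow_const_of_ne h2).mul (ContDiffAt.sub ?_ ?_)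
    · exact (bump n).contDiff.contDiffAt
    · exact ((bump n).contDiff.comp (contDiff_const_smul (2 : ℝ))).contDiffAt

lemma chiR_support (a : ℝ) : HasCompactSupport (chiR (n := n) a) := by
  refine HasCompactSupport.intro (isCompact_closedBall (0 : Eucl n) 2) fun x hx => ?_
  rw [mem_closedBall_zero_iff, not_le] at hx
  unfold chiR
  rw [bump_zero hx.le, bump_zero (by rw [norm_smul]; norm_num; linarith)]
  simp

/-- The localized symbol at scale `c`, as a Schwartz function. -/
noncomputable def chiS (a c : ℝ) (hc : 0 < c) : 𝓢(Eucl n, ℂ) :=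
  HasCompactSupport.toSchwartzMap (f := fun ξ : Eucl n => ((chiR a (c • ξ) : ℝ) : ℂ))
    (((chiR_support a).comp_homeomorph (Homeomorph.smulOfNeZero c hc.ne')).comp_left
      Complex.ofReal_zero)
    (Complex.ofRealCLM.contDiff.comp ((chiR_contDiff a).comp (contDiff_const_smul c)))

lemma chiS_apply (a c : ℝ) (hc : 0 < c) (ξ : Eucl n) :
    chiS a c hc ξ = ((chiR a (c • ξ) : ℝ) : ℂ) := rfl

lemma chiR_dil (a c : ℝ) (hc : 0 < c) (ξ : Eucl n) :
    c ^ (-a) * chiR a (c • ξ) =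
      (2 * π * ‖ξ‖) ^ a * (bump n (c • ξ) - bump n ((2 * c) • ξ)) := by
  unfold chiR
  rw [norm_smul, smul_smul, Real.norm_of_nonneg hc.le,
    show 2 * π * (c * ‖ξ‖) = c * (2 * π * ‖ξ‖) by ring,
    Real.mul_rpow hc.le (by positivity), ← mul_assoc, ← mul_assoc, ← Real.rpow_add hc]
  simp

/-- A dyadic piece. -/
lemma exists_piece (a c : ℝ) (hc : 0 < c) (ψ : 𝓢(Eucl n, ℂ)) :
    ∃ g : 𝓢(Eucl n, ℂ),
      (∀ ξ, g ξ = (((2 * π * ‖ξ‖) ^ a * (bump n (c • ξ) - bump n ((2 * c) • ξ)) : ℝ) : ℂ) * ψ ξ) ∧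
      nrm g ≤ ENNReal.ofReal (c ^ (-a)) * (nrm (chiS (n := n) a 1 one_pos) * nrm ψ) := by
  refine ⟨((c ^ (-a) : ℝ) : ℂ) • pairing (ContinuousLinearMap.mul ℂ ℂ) (chiS a c hc) ψ, ?_, ?_⟩
  · intro ξ
    rw [← chiR_dil a c hc ξ]
    simp [chiS_apply, mul_assoc]
  · rw [nrm_smul _ (by positivity)]
    gcongr
    refine (nrm_mul _ _).trans ?_
    rw [nrm_dil (chiS a 1 one_pos) (chiS a c hc) c hc (fun ξ => by simp [chiS_apply])]

/-- Geometric sums of dyadic pieces. -/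
lemma geom_bound (ρ : ℝ) (h0 : 0 ≤ ρ) (h1 : ρ < 1) (N : ℕ) :
    ∑ i ∈ Finset.range N, ENNReal.ofReal (ρ ^ i) ≤ ENNReal.ofReal ((1 - ρ)⁻¹) := by
  rw [← ENNReal.ofReal_sum_of_nonneg (fun i _ => by positivity)]
  apply ENNReal.ofReal_le_ofReal
  rw [← tsum_geometric_of_lt_one h0 h1]
  exact (summable_geometric_of_lt_one h0 h1).sum_le_tsum _ (fun i _ => by positivity)

/-- multiplication by `|2πξ|^{2m}`. -/
lemma exists_pow (m : ℕ) (φ : 𝓢(Eucl n, ℂ)) :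
    ∃ ψ : 𝓢(Eucl n, ℂ), ∀ ξ, ψ ξ = (((2 * π * ‖ξ‖) ^ (2 * m) : ℝ) : ℂ) * φ ξ := by
  have h : Function.HasTemperateGrowth (fun ξ : Eucl n => ((2 * π) ^ 2 * ‖ξ‖ ^ 2) ^ m) :=
    ((Function.HasTemperateGrowth.const _).mul (Function.hasTemperateGrowth_norm_sq _)).pow m
  refine ⟨smulLeftCLM ℂ (fun ξ : Eucl n => ((2 * π) ^ 2 * ‖ξ‖ ^ 2) ^ m) φ, fun ξ => ?_⟩
  rw [smulLeftCLM_apply_apply h, pow_mul, mul_pow (2 * π)]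
  simp

/-- The truncated symbols have uniformly bounded `L¹` norm on the Fourier side. -/
lemma exists_trunc (s : ℝ) (hs : 0 < s) (φ : 𝓢(Eucl n, ℂ)) :
    ∃ K : ℝ≥0∞, K < ⊤ ∧ ∀ N : ℕ, ∃ g : 𝓢(Eucl n, ℂ),
      (∀ ξ, g ξ = (((2 * π * ‖ξ‖) ^ s *
        (bump n (((2 : ℝ) ^ N)⁻¹ • ξ) - bump n ((2 : ℝ) ^ N • ξ)) : ℝ) : ℂ) * φ ξ) ∧
      nrm g ≤ K := by
  obtain ⟨m, hm⟩ := exists_nat_gt (s / 2)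
  obtain ⟨ψ, hψ⟩ := exists_pow m φ
  have hb : s - 2 * m < 0 := by linarith
  set b : ℝ := s - 2 * m with hbdef
  set K1 := nrm (chiS (n := n) s 1 one_pos) * nrm φ
  set K2 := nrm (chiS (n := n) b 1 one_pos) * nrm ψ
  have hK1 : K1 < ⊤ := ENNReal.mul_lt_top (nrm_lt_top _) (nrm_lt_top _)
  have hK2 : K2 < ⊤ := ENNReal.mul_lt_top (nrm_lt_top _) (nrm_lt_top _)
  set ρ1 : ℝ := 2 ^ (-s) with hρ1
  set ρ2 : ℝ := 2 ^ b with hρ2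
  have h1 : ρ1 < 1 := Real.rpow_lt_one_of_one_lt_of_neg (by norm_num) (by linarith)
  have h2 : ρ2 < 1 := Real.rpow_lt_one_of_one_lt_of_neg (by norm_num) (by linarith)
  have h1' : 0 ≤ ρ1 := by positivity
  have h2' : 0 ≤ ρ2 := by positivity
  have hp1 : ∀ i : ℕ, (0 : ℝ) < 2 ^ i := fun i => by positivity
  have hp2 : ∀ i : ℕ, (0 : ℝ) < ((2 : ℝ) ^ (i + 1))⁻¹ := fun i => by positivity
  choose g1 hg1 hg1' using fun i : ℕ => exists_piece s (2 ^ i) (hp1 i) φ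
  choose g2 hg2 hg2' using fun i : ℕ => exists_piece b ((2 ^ (i + 1))⁻¹) (hp2 i) ψ
  refine ⟨ENNReal.ofReal ((1 - ρ1)⁻¹) * K1 + ENNReal.ofReal ((1 - ρ2)⁻¹) * K2,
    ENNReal.add_lt_top.2 ⟨ENNReal.mul_lt_top ENNReal.ofReal_lt_top hK1,
      ENNReal.mul_lt_top ENNReal.ofReal_lt_top hK2⟩, fun N => ?_⟩
  refine ⟨∑ i ∈ Finset.range N, g1 i + ∑ i ∈ Finset.range N, g2 i, fun ξ => ?_, ?_⟩
  · have e1 : ∀ i, g1 i ξ = (((2 * π * ‖ξ‖) ^ s : ℝ) : ℂ) * φ ξ *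
        (((bump n ((2 : ℝ) ^ i • ξ) : ℝ) : ℂ) - ((bump n ((2 : ℝ) ^ (i + 1) • ξ) : ℝ) : ℂ)) := by
      intro i
      rw [hg1, show 2 * (2 : ℝ) ^ i = 2 ^ (i + 1) by ring]
      push_cast
      ring
    have e2 : ∀ i, g2 i ξ = (((2 * π * ‖ξ‖) ^ s : ℝ) : ℂ) * φ ξ *
        (((bump n (((2 : ℝ) ^ (i + 1))⁻¹ • ξ) : ℝ) : ℂ) -
          ((bump n (((2 : ℝ) ^ i)⁻¹ • ξ) : ℝ) : ℂ)) := by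
      intro i
      rw [hg2, hψ, show 2 * ((2 : ℝ) ^ (i + 1))⁻¹ = (2 ^ i)⁻¹ by rw [pow_succ]; field_simp]
      by_cases hξ : ξ = 0
      · subst hξ
        simp
      · have hpos : 0 < 2 * π * ‖ξ‖ := by
          have := norm_pos_iff.2 hξ
          positivity
        have : (2 * π * ‖ξ‖) ^ s = (2 * π * ‖ξ‖) ^ b * (2 * π * ‖ξ‖) ^ (2 * m) := by
          rw [← Real.rpow_natCast, ← Real.rpow_add hpos]
          congr 1
          rw [hbdef]; push_cast; ring
        rw [this]
        push_cast
        ring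
    rw [_root_.add_apply, _root_.sum_apply, _root_.sum_apply]
    simp_rw [e1, e2]
    rw [← Finset.mul_sum, ← Finset.mul_sum,
      Finset.sum_range_sub' (fun i => ((bump n ((2 : ℝ) ^ i • ξ) : ℝ) : ℂ)),
      Finset.sum_range_sub (fun i => ((bump n (((2 : ℝ) ^ i)⁻¹ • ξ) : ℝ) : ℂ))]
    push_cast
    simp only [pow_zero, inv_one]
    ring
  · refine (nrm_add _ _).trans (add_le_add ?_ ?_)
    · refine (nrm_sum _ _).trans ((Finset.sum_le_sum fun i _ => hg1' i).trans ?_)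
      rw [← Finset.sum_mul]
      gcongr
      refine le_trans (le_of_eq ?_) (geom_bound ρ1 h1' h1 N)
      refine Finset.sum_congr rfl fun i _ => ?_
      rw [hρ1, ← Real.rpow_natCast, ← Real.rpow_natCast, ← Real.rpow_mul (by norm_num),
        ← Real.rpow_mul (by norm_num), mul_comm]
    · refine (nrm_sum _ _).trans ((Finset.sum_le_sum fun i _ => hg2' i).trans ?_)
      rw [← Finset.sum_mul]
      gcongr
      refine le_trans (Finset.sum_le_sum fun i _ => ?_) (geom_bound ρ2 h2' h2 N)
      apply ENNReal.ofReal_le_ofReal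
      calc (((2 : ℝ) ^ (i + 1))⁻¹) ^ (-b) = ρ2 ^ (i + 1) := by
            rw [Real.inv_rpow (by positivity), ← Real.rpow_neg (by positivity), neg_neg, hρ2,
              ← Real.rpow_natCast, ← Real.rpow_natCast, ← Real.rpow_mul (by norm_num),
              ← Real.rpow_mul (by norm_num), mul_comm]
        _ ≤ ρ2 ^ i := pow_le_pow_of_le_one h2' h2.le (Nat.le_succ i)

end FL10

namespace FL10

open SchwartzMap Filter

variable {n : ℕ}

/-- The symbol applied to a Schwartz function. -/
noncomputable def symb (s : ℝ) (φ : 𝓢(Eucl n, ℂ)) (ξ : Eucl n) : ℂ :=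
  (((2 * π * ‖ξ‖) ^ s : ℝ) : ℂ) * φ ξ

lemma symb_continuous (s : ℝ) (hs : 0 ≤ s) (φ : 𝓢(Eucl n, ℂ)) : Continuous (symb s φ) := by
  unfold symb
  refine (Complex.continuous_ofReal.comp ?_).mul φ.continuous
  exact (continuous_const.mul continuous_norm).rpow_const (fun _ => Or.inr hs)

lemma symb_integrable (s : ℝ) (hs : 0 ≤ s) (φ : 𝓢(Eucl n, ℂ)) : Integrable (symb s φ) := by
  obtain ⟨m, hm⟩ := exists_nat_gt (s / 2)
  obtain ⟨ψ, hψ⟩ := exists_pow m φ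
  refine Integrable.mono' (φ.integrable.norm.add ψ.integrable.norm)
    (symb_continuous s hs φ).aestronglyMeasurable (Eventually.of_forall fun ξ => ?_)
  have h0 : 0 ≤ 2 * π * ‖ξ‖ := by positivity
  simp only [Pi.add_apply]
  rw [symb, hψ, norm_mul, norm_mul, Complex.norm_real, Complex.norm_real,
    Real.norm_of_nonneg (by positivity), Real.norm_of_nonneg (by positivity)]
  have : (2 * π * ‖ξ‖) ^ s ≤ 1 + (2 * π * ‖ξ‖) ^ (2 * m) := by
    rcases le_total (2 * π * ‖ξ‖) 1 with h | h
    · have h1 := Real.rpow_le_one h0 h hs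
      have : 0 ≤ (2 * π * ‖ξ‖) ^ (2 * m) := by positivity
      linarith
    · have : (2 * π * ‖ξ‖) ^ s ≤ (2 * π * ‖ξ‖) ^ (((2 * m : ℕ) : ℝ)) :=
        Real.rpow_le_rpow_of_exponent_le h (by push_cast; linarith)
      rw [Real.rpow_natCast] at this
      linarith
  calc _ ≤ (1 + (2 * π * ‖ξ‖) ^ (2 * m)) * ‖φ ξ‖ := by gcongr
    _ = _ := by ring

lemma fourierInv_continuous {h : Eucl n → ℂ} (hh : Integrable h) : Continuous (𝓕⁻ h) := by
  have : Continuous (𝓕 h) := VectorFourier.fourierIntegral_continuous Real.continuous_fourierChar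
    (by exact continuous_inner) hh
  have h2 : 𝓕⁻ h = fun x => 𝓕 h (-x) := by
    ext x
    exact Real.fourierInv_eq_fourier_neg h x
  rw [h2]
  exact this.comp continuous_neg

lemma fourierInv_bound (h : Eucl n → ℂ) (x : Eucl n) : ‖𝓕⁻ h x‖ ≤ ∫ ξ, ‖h ξ‖ := by
  rw [Real.fourierInv_eq]
  refine (norm_integral_le_integral_norm _).trans (le_of_eq ?_)
  simp [Circle.norm_smul]

lemma symb_lim (s : ℝ) (hs' : 0 < s) (φ : 𝓢(Eucl n, ℂ)) (g : ℕ → 𝓢(Eucl n, ℂ))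
    (hg : ∀ N ξ, g N ξ = (((2 * π * ‖ξ‖) ^ s *
        (bump n (((2 : ℝ) ^ N)⁻¹ • ξ) - bump n ((2 : ℝ) ^ N • ξ)) : ℝ) : ℂ) * φ ξ) (x : Eucl n) :
    Tendsto (fun N => (𝓕⁻ (g N)) x) atTop (𝓝 (𝓕⁻ (symb s φ) x)) := by
  simp_rw [SchwartzMap.fourierInv_coe, Real.fourierInv_eq]
  refine tendsto_integral_of_dominated_convergence (fun ξ => ‖symb s φ ξ‖) ?_
    (symb_integrable s hs'.le φ).norm ?_ ?_
  · intro N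
    refine Continuous.aestronglyMeasurable ?_
    have h1 : Continuous fun ξ : Eucl n => inner ℝ ξ x := continuous_id.inner continuous_const
    exact (Real.continuous_fourierChar.comp h1).smul (g N).continuous
  · intro N
    refine Eventually.of_forall fun ξ => ?_
    rw [Circle.norm_smul, hg, symb, norm_mul, norm_mul, Complex.norm_real, Complex.norm_real,
      norm_mul]
    gcongr
    have a1 := (bump n).nonneg' (((2 : ℝ) ^ N)⁻¹ • ξ)
    have a2 := (bump n).nonneg' (((2 : ℝ) ^ N) • ξ)
    have a3 := (bump n).le_one (x := (((2 : ℝ) ^ N)⁻¹ • ξ))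
    have a4 := (bump n).le_one (x := (((2 : ℝ) ^ N) • ξ))
    have : ‖bump n (((2 : ℝ) ^ N)⁻¹ • ξ) - bump n ((2 : ℝ) ^ N • ξ)‖ ≤ 1 := by
      rw [Real.norm_eq_abs, abs_le]
      constructor <;> linarith
    exact mul_le_of_le_one_right (norm_nonneg _) this
  · refine Eventually.of_forall fun ξ => ?_
    refine Tendsto.const_smul ?_ _
    refine tendsto_const_nhds.congr' ?_
    by_cases hξ : ξ = 0
    · subst hξ
      refine Eventually.of_forall fun N => ?_
      change symb s φ 0 = g N 0
      rw [hg, symb]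
      simp [Real.zero_rpow hs'.ne']
    · have hpos := norm_pos_iff.2 hξ
      have t : Tendsto (fun N : ℕ => (2 : ℝ) ^ N) atTop atTop :=
        tendsto_pow_atTop_atTop_of_one_lt one_lt_two
      filter_upwards [t.eventually_ge_atTop ‖ξ‖, t.eventually_ge_atTop (2 / ‖ξ‖)] with N h1 h2
      change symb s φ ξ = g N ξ
      rw [hg, symb, bump_one, bump_zero]
      · simp
      · rw [norm_smul, Real.norm_of_nonneg (by positivity)]
        rwa [div_le_iff₀ hpos] at h2
      · rw [norm_smul, Real.norm_of_nonneg (by positivity), inv_mul_le_iff₀ (by positivity)]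
        simpa using h1

lemma fatou_aux (F : Eucl n → ℂ) (G : ℕ → Eucl n → ℂ) (K : ℝ≥0∞)
    (hG : ∀ N, Continuous (G N)) (hK : ∀ N, ∫⁻ x, ‖G N x‖ₑ ≤ K)
    (hlim : ∀ x, Tendsto (fun N => G N x) atTop (𝓝 (F x))) : ∫⁻ x, ‖F x‖ₑ ≤ K := by
  have h1 : ∀ x, ‖F x‖ₑ = liminf (fun N => ‖G N x‖ₑ) atTop := fun x =>
    ((hlim x).enorm.liminf_eq).symm
  simp_rw [h1]
  refine (lintegral_liminf_le fun N => (hG N).enorm.measurable).trans ?_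
  exact liminf_le_of_frequently_le' (Frequently.of_forall hK)

lemma symb_L1_pos (s : ℝ) (hs : 0 < s) (φ : 𝓢(Eucl n, ℂ)) :
    ∫⁻ x, ‖𝓕⁻ (symb s φ) x‖ₑ < ⊤ := by
  obtain ⟨K, hK, hg⟩ := exists_trunc s hs φ
  choose g hg hgK using hg
  refine lt_of_le_of_lt ?_ hK
  exact fatou_aux _ (fun N => (𝓕⁻ (g N) : 𝓢(Eucl n, ℂ))) K (fun N => (𝓕⁻ (g N)).continuous) hgK
    (symb_lim s hs φ g hg)

lemma symb_L1 (s : ℝ) (hs : 0 ≤ s) (φ : 𝓢(Eucl n, ℂ)) :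
    ∫⁻ x, ‖𝓕⁻ (symb s φ) x‖ₑ < ⊤ := by
  by_cases h0 : s = 0
  · have h : symb s φ = φ := by
      ext ξ
      simp [symb, h0]
    rw [h, ← SchwartzMap.fourierInv_coe]
    exact nrm_lt_top φ
  · exact symb_L1_pos s (lt_of_le_of_ne hs (Ne.symm h0)) φ

lemma fracLap_eq (s : ℝ) (f : 𝓢(Eucl n, ℝ)) : ∃ φ : 𝓢(Eucl n, ℂ),
    fracLap s f = fun x => (𝓕⁻ (symb s φ) x).re := by
  refine ⟨𝓕 (f.postcompCLM Complex.ofRealCLM), ?_⟩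
  ext x
  rfl

/-- `Δ^{s/2} f` is continuous, bounded and integrable. -/
lemma fracLap_bounds (s : ℝ) (hs : 0 ≤ s) (f : 𝓢(Eucl n, ℝ)) :
    Measurable (fracLap s f) ∧ ∃ A > (0 : ℝ), ∃ M > (0 : ℝ),
      (∫⁻ x, ‖fracLap s f x‖ₑ ≤ ENNReal.ofReal A) ∧ ∀ x, |fracLap s f x| ≤ M := by
  obtain ⟨φ, hφ⟩ := fracLap_eq s f
  rw [hφ]
  have hi := symb_integrable s hs φ
  refine ⟨(Complex.continuous_re.comp (fourierInv_continuous hi)).measurable,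
    (∫⁻ x, ‖𝓕⁻ (symb s φ) x‖ₑ).toReal + 1, by positivity, (∫ ξ, ‖symb s φ ξ‖) + 1,
    add_pos_of_nonneg_of_pos (integral_nonneg fun _ => norm_nonneg _) one_pos, ?_, fun x => ?_⟩
  · refine le_trans (lintegral_mono fun x => ?_)
      (le_trans (ENNReal.ofReal_toReal (symb_L1 s hs φ).ne).ge
      (ENNReal.ofReal_le_ofReal (by linarith)))
    rw [← ofReal_norm, ← ofReal_norm]
    exact ENNReal.ofReal_le_ofReal (Complex.abs_re_le_norm _)
  · have := Complex.abs_re_le_norm (𝓕⁻ (symb s φ) x)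
    have := fourierInv_bound (symb s φ) x
    linarith

/-- Scaling of `Δ^{s/2}`. -/
lemma fracLap_scale (s : ℝ) (f : Eucl n → ℝ) (c : ℝ) (hc : 0 < c) (x₀ x : Eucl n) :
    fracLap s (fun y => f (c⁻¹ • (y - x₀))) x = c ^ (-s) * fracLap s f (c⁻¹ • (x - x₀)) := by
  have hF : ∀ ξ : Eucl n, 𝓕 (fun y : Eucl n => ((f (c⁻¹ • (y - x₀)) : ℝ) : ℂ)) ξ =
      ((c ^ n : ℝ) : ℂ) * (𝐞 (-inner ℝ x₀ ξ) * 𝓕 (fun y : Eucl n => ((f y : ℝ) : ℂ)) (c • ξ)) := by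
    intro ξ
    rw [Real.fourier_eq, Real.fourier_eq, ← integral_add_right_eq_self _ x₀]
    have h := Measure.integral_comp_smul_of_nonneg volume
      (fun v : Eucl n => 𝐞 (-inner ℝ v (c • ξ)) • ((f v : ℝ) : ℂ)) c⁻¹
      (hR := (inv_pos.2 hc).le)
    rw [finrank_eucl] at h
    have h2 : (∫ v : Eucl n, 𝐞 (-inner ℝ v (c • ξ)) • ((f v : ℝ) : ℂ)) =
      (((c ^ n)⁻¹ : ℝ) : ℂ) * ∫ v : Eucl n, 𝐞 (-inner ℝ (c⁻¹ • v) (c • ξ)) • ((f (c⁻¹ • v) : ℝ) : ℂ) := by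
      rw [h, Complex.real_smul, ← mul_assoc, ← Complex.ofReal_mul]
      have : c ^ n ≠ 0 := by positivity
      simp [this]
    rw [h2]
    have hcn : ((c ^ n : ℝ) : ℂ) ≠ 0 := by exact_mod_cast (by positivity : c ^ n ≠ 0)
    rw [mul_left_comm (_ : ℂ) (((c ^ n)⁻¹ : ℝ) : ℂ), Complex.ofReal_inv, mul_inv_cancel_left₀ hcn,
      ← integral_const_mul]
    refine integral_congr_ae (Eventually.of_forall fun v => ?_)
    simp only [add_sub_cancel_right]
    rw [inner_smul_left, inner_smul_right, inner_add_left, neg_add, AddChar.map_add_eq_mul,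
      Circle.smul_def, Circle.smul_def]
    simp only [conj_trivial, inv_mul_cancel_left₀ hc.ne', smul_eq_mul, Circle.coe_mul]
    ring
  set G : Eucl n → ℂ := fun ζ => (((2 * π * ‖ζ‖) ^ s : ℝ) : ℂ) * 𝓕 (fun y : Eucl n => ((f y : ℝ) : ℂ)) ζ
    with hG
  have key : 𝓕⁻ (fun ξ : Eucl n => (((2 * π * ‖ξ‖) ^ s : ℝ) : ℂ) *
      𝓕 (fun y : Eucl n => ((f (c⁻¹ • (y - x₀)) : ℝ) : ℂ)) ξ) x =
      ((c ^ (-s) : ℝ) : ℂ) * 𝓕⁻ G (c⁻¹ • (x - x₀)) := by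
    have h3 : 𝓕⁻ G (c⁻¹ • (x - x₀)) =
        ((c ^ n : ℝ) : ℂ) * 𝓕⁻ (fun ξ => G (c • ξ)) (x - x₀) := by
      rw [fourierInv_dil G c hc, Complex.real_smul, ← mul_assoc, ← Complex.ofReal_mul]
      have : c ^ n ≠ 0 := by positivity
      simp [this]
    rw [h3, Real.fourierInv_eq, Real.fourierInv_eq, ← integral_const_mul, ← integral_const_mul]
    refine integral_congr_ae (Eventually.of_forall fun ξ => ?_)
    simp only [hF, hG]
    rw [norm_smul, Real.norm_of_nonneg hc.le, show 2 * π * (c * ‖ξ‖) = c * (2 * π * ‖ξ‖) by ring,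
      Real.mul_rpow hc.le (by positivity), inner_sub_right, sub_eq_add_neg,
      AddChar.map_add_eq_mul, ← real_inner_comm ξ x₀, Circle.smul_def, Circle.smul_def]
    have hcs : ((c ^ (-s) : ℝ) : ℂ) * ((c ^ s : ℝ) : ℂ) = 1 := by
      rw [← Complex.ofReal_mul, ← Real.rpow_add hc]
      simp
    simp only [smul_eq_mul, Circle.coe_mul, Complex.ofReal_mul]
    linear_combination (-(𝐞 (inner ℝ ξ x) : ℂ) * (𝐞 (-inner ℝ x₀ ξ) : ℂ) * ((c ^ n : ℝ) : ℂ) *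
      (((2 * π * ‖ξ‖) ^ s : ℝ) : ℂ) * 𝓕 (fun y : Eucl n => ((f y : ℝ) : ℂ)) (c • ξ)) * hcs
  unfold fracLap
  rw [key, Complex.re_ofReal_mul]

end FL10

namespace FL10

open Filter

variable {n : ℕ}

lemma decRear_le_sup (g : Eucl n → ℝ) (M : ℝ) (hM : 0 < M) (h : ∀ x, |g x| ≤ M) (t : ℝ) :
    decRear g t ≤ ENNReal.ofReal M := by
  unfold decRear
  refine iInf₂_le_of_le M.toNNReal ?_ le_rfl
  have : {x : Eucl n | ((M.toNNReal : ℝ≥0) : ℝ) < |g x|} = ∅ := by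
    ext x
    simp [Real.coe_toNNReal M hM.le, h x]
  rw [this]
  simp

lemma decRear_le_L1 (g : Eucl n → ℝ) (hg : Measurable g) (A : ℝ) (hA : 0 < A)
    (h : ∫⁻ x, ‖g x‖ₑ ≤ ENNReal.ofReal A) (t : ℝ) (ht : 0 < t) :
    decRear g t ≤ ENNReal.ofReal (A / t) := by
  have hAt : 0 < A / t := by positivity
  unfold decRear
  refine iInf₂_le_of_le (A / t).toNNReal ?_ le_rfl
  have h1 : {x : Eucl n | (((A / t).toNNReal : ℝ≥0) : ℝ) < |g x|} ⊆
      {x | ENNReal.ofReal (A / t) ≤ ‖g x‖ₑ} := by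
    intro x hx
    simp only [mem_ofPred_eq, Real.coe_toNNReal _ hAt.le] at hx ⊢
    rw [← ofReal_norm]
    exact ENNReal.ofReal_le_ofReal hx.le
  refine (measure_mono h1).trans ?_
  refine (meas_ge_le_lintegral_div hg.enorm.aemeasurable (by simpa using hAt)
    ENNReal.ofReal_ne_top).trans ?_
  refine (ENNReal.div_le_div_right h _).trans ?_
  rw [← ENNReal.ofReal_div_of_pos hAt]
  apply ENNReal.ofReal_le_ofReal
  rw [div_div_cancel₀ hA.ne']

lemma decRear_antitone (g : Eucl n → ℝ) : Antitone (decRear g) := by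
  intro a b hab
  unfold decRear
  refine le_iInf₂ fun c hc => iInf₂_le_of_le c (hc.trans (ENNReal.ofReal_le_ofReal hab)) le_rfl

lemma lorentz_11 (g : Eucl n → ℝ) (hg : Measurable g) :
    lorentzNorm 1 1 g ≤ ∫⁻ x, ‖g x‖ₑ := by
  have h0 : lorentzNorm 1 1 g = ∫⁻ t in Ioi (0 : ℝ), decRear g t := by
    unfold lorentzNorm
    rw [if_neg ENNReal.one_ne_top]
    simp only [ENNReal.toReal_one, div_one, ENNReal.rpow_one, Real.rpow_one]
    refine setLIntegral_congr_fun measurableSet_Ioi fun t ht => ?_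
    have h1 : ENNReal.ofReal t ≠ 0 := by simpa using ht
    rw [mul_div_assoc, ENNReal.mul_div_cancel h1 ENNReal.ofReal_ne_top]
  rw [h0]
  have hmeas : Measurable (decRear g) := (decRear_antitone g).measurable
  have hν : Antitone fun r : ℝ => volume {x : Eucl n | r < |g x|} := fun a b hab =>
    measure_mono fun x hx => lt_of_le_of_lt hab hx
  -- the layer cake formula for `|g|`
  have hcake : ∫⁻ x, ‖g x‖ₑ = ∫⁻ r in Ioi (0 : ℝ), volume {x : Eucl n | r < |g x|} := by
    rw [← lintegral_eq_lintegral_meas_lt volume (f := fun x => |g x|)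
      (Eventually.of_forall fun x => abs_nonneg _) hg.abs.aemeasurable]
    refine lintegral_congr fun x => ?_
    rw [← ofReal_norm, Real.norm_eq_abs]
  rw [hcake]
  set D : ℝ × ℝ → ℝ≥0∞ := fun z =>
    {z : ℝ × ℝ | ENNReal.ofReal z.1 < volume {x : Eucl n | z.2 < |g x|}}.indicator 1 z with hD
  have hDm : Measurable D := by
    refine measurable_one.indicator (measurableSet_lt ?_ ?_)
    · exact ENNReal.measurable_ofReal.comp measurable_fst
    · exact hν.measurable.comp measurable_snd
  calc ∫⁻ t in Ioi (0 : ℝ), decRear g t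
      ≤ ∫⁻ t in Ioi (0 : ℝ), ∫⁻ r in Ioi (0 : ℝ), D (t, r) := by
        refine setLIntegral_mono' measurableSet_Ioi fun t ht => ?_
        -- the superlevel set contains an interval of the right length
        refine ENNReal.le_of_forall_pos_nnreal_lt ?_
        intro c hc hlt
        have hsub : Ioo (0 : ℝ) c ⊆ {r | D (t, r) = 1} ∩ Ioi 0 := by
          intro r hr
          refine ⟨?_, hr.1⟩
          simp only [mem_ofPred_eq, hD]
          rw [indicator_of_mem]
          · rfl
          · simp only [mem_ofPred_eq]
            by_contra hcon
            rw [not_lt] at hcon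
            have : decRear g t ≤ ENNReal.ofReal r := by
              unfold decRear
              refine iInf₂_le_of_le r.toNNReal ?_ le_rfl
              rwa [Real.coe_toNNReal _ hr.1.le]
            have h2 : ENNReal.ofReal r ≤ c := by
              rw [← ENNReal.ofReal_coe_nnreal]
              exact ENNReal.ofReal_le_ofReal hr.2.le
            exact absurd hlt (not_lt.2 (this.trans h2))
        calc (c : ℝ≥0∞) = ∫⁻ r in Ioo (0 : ℝ) c, 1 := by simp
          _ = ∫⁻ r in Ioo (0 : ℝ) c, D (t, r) :=
              setLIntegral_congr_fun measurableSet_Ioo fun r hr => ((hsub hr).1).symm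
          _ ≤ _ := lintegral_mono_set Ioo_subset_Ioi_self
    _ = ∫⁻ r in Ioi (0 : ℝ), ∫⁻ t in Ioi (0 : ℝ), D (t, r) :=
        lintegral_lintegral_swap hDm.aemeasurable
    _ ≤ ∫⁻ r in Ioi (0 : ℝ), volume {x : Eucl n | r < |g x|} := by
        refine lintegral_mono fun r => ?_
        simp only
        rcases eq_or_ne (volume {x : Eucl n | r < |g x|}) ⊤ with h | h
        · rw [h]; exact le_top
        · set V := volume {x : Eucl n | r < |g x|} with hV
          calc ∫⁻ t in Ioi (0 : ℝ), D (t, r)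
              ≤ ∫⁻ t in Ioi (0 : ℝ), (Iio V.toReal).indicator 1 t := by
                refine setLIntegral_mono' measurableSet_Ioi fun t ht => ?_
                simp only [hD]
                by_cases hm : ENNReal.ofReal t < V
                · rw [indicator_of_mem (show t ∈ Iio V.toReal from
                    (ENNReal.ofReal_lt_iff_lt_toReal (le_of_lt ht) h).1 hm)]
                  exact indicator_le_self' (fun _ _ => zero_le) _
                · rw [indicator_of_notMem (by simpa using hm)]
                  exact zero_le
            _ = volume (Iio V.toReal ∩ Ioi 0) := by
                rw [lintegral_indicator_one measurableSet_Iio,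
                  Measure.restrict_apply measurableSet_Iio]
            _ = volume (Ioo 0 V.toReal) := by
                congr 1
                ext y
                simp [and_comm]
            _ = V := by simp [h]

/-- The interpolation bound. -/
lemma lorentz_bound (p q : ℝ≥0∞)
    (hpq : (1 < p ∧ p < ⊤ ∧ 1 ≤ q) ∨ (p = 1 ∧ q = 1) ∨ (p = ⊤ ∧ q = ⊤)) :
    ∃ C > (0 : ℝ), ∀ g : Eucl n → ℝ, Measurable g → ∀ A > (0 : ℝ), ∀ M > (0 : ℝ),
      ∫⁻ x, ‖g x‖ₑ ≤ ENNReal.ofReal A → (∀ x, |g x| ≤ M) →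
      lorentzNorm p q g ≤
        ENNReal.ofReal (C * (A ^ (1 / p).toReal * M ^ (1 - (1 / p).toReal))) := by
  rcases hpq with ⟨hp1, hp2, hq⟩ | ⟨rfl, rfl⟩ | ⟨rfl, rfl⟩
  · set θ := (1 / p).toReal with hθ
    have hpr : 1 < p.toReal := by
      rw [← ENNReal.toReal_one]
      exact (ENNReal.toReal_lt_toReal ENNReal.one_ne_top hp2.ne).2 hp1
    have hθ' : θ = 1 / p.toReal := by simp [hθ]
    have hθ0 : 0 < θ := by rw [hθ']; positivity
    have hθ1 : θ < 1 := by rw [hθ', div_lt_one (by positivity)]; exact hpr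
    rcases eq_or_ne q ⊤ with rfl | hqt
    · refine ⟨1, one_pos, fun g hg A hA M hM h1 h2 => ?_⟩
      unfold lorentzNorm
      rw [if_pos rfl, if_neg hp2.ne]
      refine iSup_le fun t => ?_
      obtain ⟨t, ht⟩ := t
      simp only [one_mul]
      have hd : decRear g t ≤ ENNReal.ofReal ((A / t) ^ θ * M ^ (1 - θ)) := by
        rcases le_total M (A / t) with h | h
        · refine (decRear_le_sup g M hM h2 t).trans (ENNReal.ofReal_le_ofReal ?_)
          calc M = M ^ θ * M ^ (1 - θ) := by rw [← Real.rpow_add hM]; simp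
            _ ≤ _ := by gcongr
        · refine (decRear_le_L1 g hg A hA h1 t ht).trans (ENNReal.ofReal_le_ofReal ?_)
          have hAt : 0 < A / t := by positivity
          calc A / t = (A / t) ^ θ * (A / t) ^ (1 - θ) := by rw [← Real.rpow_add hAt]; simp
            _ ≤ _ := by
              have : 0 ≤ 1 - θ := by linarith
              gcongr
      refine (mul_le_mul_right hd _).trans ?_
      rw [← ENNReal.ofReal_mul (by positivity)]
      apply ENNReal.ofReal_le_ofReal
      rw [Real.div_rpow hA.le ht.le]
      have : t ^ θ ≠ 0 := by positivity
      apply le_of_eq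
      rw [← hθ]
      field_simp
    · set Q := q.toReal with hQ
      have hQ1 : 1 ≤ Q := by
        rw [hQ, ← ENNReal.toReal_one]
        exact ENNReal.toReal_mono hqt hq
      have hQ0 : 0 < Q := by linarith
      set B : ℝ := 1 / (θ * Q) + 1 / ((1 - θ) * Q) with hB
      have h1θ : 0 < 1 - θ := by linarith
      have hB0 : 0 < B := by positivity
      refine ⟨B ^ (1 / Q), by positivity, fun g hg A hA M hM h1 h2 => ?_⟩
      unfold lorentzNorm
      rw [if_neg hqt, ← hQ, ← hθ]
      set τ := A / M with hτ
      have hτ0 : 0 < τ := by positivity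
      have e1 : ∫⁻ t in Ioc (0 : ℝ) τ,
          (ENNReal.ofReal (t ^ θ) * decRear g t) ^ Q / ENNReal.ofReal t ≤
          ENNReal.ofReal (M ^ Q * (τ ^ (θ * Q) / (θ * Q))) := by
        have hexp : (-1 : ℝ) < θ * Q - 1 := by
          have : 0 < θ * Q := by positivity
          linarith
        have hint : IntegrableOn (fun t : ℝ => M ^ Q * t ^ (θ * Q - 1)) (Ioc 0 τ) := by
          refine Integrable.const_mul ?_ _
          exact (intervalIntegrable_iff_integrableOn_Ioc_of_le hτ0.le).1
            (intervalIntegral.intervalIntegrable_rpow' hexp)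
        calc _ ≤ ∫⁻ t in Ioc (0 : ℝ) τ, ENNReal.ofReal (M ^ Q * t ^ (θ * Q - 1)) := by
              refine setLIntegral_mono' measurableSet_Ioc fun t ht => ?_
              have ht0 : 0 < t := ht.1
              calc _ ≤ (ENNReal.ofReal (t ^ θ) * ENNReal.ofReal M) ^ Q / ENNReal.ofReal t := by
                    gcongr
                    exact decRear_le_sup g M hM h2 t
                _ = _ := by
                    rw [← ENNReal.ofReal_mul (by positivity),
                      ENNReal.ofReal_rpow_of_nonneg (by positivity) hQ0.le,
                      ← ENNReal.ofReal_div_of_pos ht0]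
                    congr 1
                    rw [Real.mul_rpow (by positivity) hM.le, ← Real.rpow_mul ht0.le,
                      Real.rpow_sub_one ht0.ne']
                    ring
          _ = ENNReal.ofReal (∫ t in Ioc (0 : ℝ) τ, M ^ Q * t ^ (θ * Q - 1)) := by
              rw [ofReal_integral_eq_lintegral_ofReal hint]
              filter_upwards [ae_restrict_mem measurableSet_Ioc] with t ht
              have := ht.1
              simp only [Pi.zero_apply]
              positivity
          _ = _ := by
              rw [integral_const_mul, ← intervalIntegral.integral_of_le hτ0.le,
                integral_rpow (Or.inl hexp)]
              simp [Real.zero_rpow (show θ * Q ≠ 0 by positivity)]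
      have e2 : ∫⁻ t in Ioi τ,
          (ENNReal.ofReal (t ^ θ) * decRear g t) ^ Q / ENNReal.ofReal t ≤
          ENNReal.ofReal (A ^ Q * (τ ^ (-((1 - θ) * Q)) / ((1 - θ) * Q))) := by
        have hexp : -((1 - θ) * Q) - 1 < -1 := by
          have : 0 < (1 - θ) * Q := by positivity
          linarith
        have hint : IntegrableOn (fun t : ℝ => A ^ Q * t ^ (-((1 - θ) * Q) - 1)) (Ioi τ) :=
          Integrable.const_mul (integrableOn_Ioi_rpow_of_lt hexp hτ0) _
        calc _ ≤ ∫⁻ t in Ioi τ, ENNReal.ofReal (A ^ Q * t ^ (-((1 - θ) * Q) - 1)) := by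
              refine setLIntegral_mono' measurableSet_Ioi fun t ht => ?_
              have ht0 : 0 < t := hτ0.trans ht
              calc _ ≤ (ENNReal.ofReal (t ^ θ) * ENNReal.ofReal (A / t)) ^ Q /
                      ENNReal.ofReal t := by
                    gcongr
                    exact decRear_le_L1 g hg A hA h1 t ht0
                _ = _ := by
                    rw [← ENNReal.ofReal_mul (by positivity),
                      ENNReal.ofReal_rpow_of_nonneg (by positivity) hQ0.le,
                      ← ENNReal.ofReal_div_of_pos ht0]
                    congr 1
                    rw [show t ^ θ * (A / t) = A * t ^ (θ - 1) by
                        rw [Real.rpow_sub_one ht0.ne']; ring,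
                      Real.mul_rpow hA.le (by positivity), ← Real.rpow_mul ht0.le,
                      Real.rpow_sub_one ht0.ne',
                      show (θ - 1) * Q = -((1 - θ) * Q) by ring]
                    ring
          _ = ENNReal.ofReal (∫ t in Ioi τ, A ^ Q * t ^ (-((1 - θ) * Q) - 1)) := by
              rw [ofReal_integral_eq_lintegral_ofReal hint]
              filter_upwards [ae_restrict_mem measurableSet_Ioi] with t ht
              have : 0 < t := hτ0.trans ht
              simp only [Pi.zero_apply]
              positivity
          _ = _ := by
              rw [integral_const_mul, integral_Ioi_rpow_of_lt hexp hτ0]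
              simp [neg_div_neg_eq]
      have e3 : ∫⁻ t in Ioi (0 : ℝ),
          (ENNReal.ofReal (t ^ θ) * decRear g t) ^ Q / ENNReal.ofReal t ≤
          ENNReal.ofReal (B * (A ^ θ * M ^ (1 - θ)) ^ Q) := by
        rw [← Ioc_union_Ioi_eq_Ioi hτ0.le]
        refine (lintegral_union_le _ _ _).trans ((add_le_add e1 e2).trans ?_)
        rw [← ENNReal.ofReal_add (by positivity) (by positivity)]
        apply ENNReal.ofReal_le_ofReal
        have i0 : (A ^ θ * M ^ (1 - θ)) ^ Q = A ^ (θ * Q) * M ^ ((1 - θ) * Q) := by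
          rw [Real.mul_rpow (by positivity) (by positivity), ← Real.rpow_mul hA.le,
            ← Real.rpow_mul hM.le]
        have i1 : M ^ Q * τ ^ (θ * Q) = A ^ (θ * Q) * M ^ ((1 - θ) * Q) := by
          rw [hτ, Real.div_rpow hA.le hM.le, show (1 - θ) * Q = Q - θ * Q by ring,
            Real.rpow_sub hM]
          ring
        have i2 : A ^ Q * τ ^ (-((1 - θ) * Q)) = A ^ (θ * Q) * M ^ ((1 - θ) * Q) := by
          rw [hτ, Real.rpow_neg (by positivity), Real.div_rpow hA.le hM.le,
            show θ * Q = Q - (1 - θ) * Q by ring, Real.rpow_sub hA]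
          field_simp
        rw [← mul_div_assoc, ← mul_div_assoc, i1, i2, i0, hB]
        apply le_of_eq
        ring
      calc _ ≤ (ENNReal.ofReal (B * (A ^ θ * M ^ (1 - θ)) ^ Q)) ^ (1 / Q) := by gcongr
        _ = _ := by
          rw [ENNReal.ofReal_rpow_of_nonneg (by positivity) (by positivity),
            Real.mul_rpow hB0.le (by positivity), ← Real.rpow_mul (by positivity),
            mul_one_div_cancel hQ0.ne', Real.rpow_one]
  · refine ⟨1, one_pos, fun g hg A hA M hM h1 h2 => ?_⟩
    refine (lorentz_11 g hg).trans (h1.trans (le_of_eq ?_))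
    simp
  · refine ⟨1, one_pos, fun g hg A hA M hM h1 h2 => ?_⟩
    unfold lorentzNorm
    rw [if_pos rfl, if_pos rfl]
    have : eLpNormEssSup g volume ≤ ENNReal.ofReal M :=
      eLpNormEssSup_le_of_ae_bound (Eventually.of_forall h2)
    simpa using this

end FL10

namespace FL10

/-- The scaling part. -/
lemma scaled_bound {n : ℕ} (s : ℝ) (f : Eucl n → ℝ) (hm : Measurable (fracLap s f)) (A M : ℝ)
    (hA : ∫⁻ x, ‖fracLap s f x‖ₑ ≤ ENNReal.ofReal A) (hM : ∀ x, |fracLap s f x| ≤ M)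
    (c : ℝ) (hc : 0 < c) (x₀ : Eucl n) :
    Measurable (fracLap s (fun y => f (c⁻¹ • (y - x₀)))) ∧
    ∫⁻ x, ‖fracLap s (fun y => f (c⁻¹ • (y - x₀))) x‖ₑ ≤
      ENNReal.ofReal (c ^ (-s) * (c ^ n * A)) ∧
    ∀ x, |fracLap s (fun y => f (c⁻¹ • (y - x₀))) x| ≤ c ^ (-s) * M := by
  have he : fracLap s (fun y => f (c⁻¹ • (y - x₀))) =
      fun x => c ^ (-s) * fracLap s f (c⁻¹ • (x - x₀)) := by
    ext x
    exact fracLap_scale s f c hc x₀ x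
  have hcs : 0 < c ^ (-s) := by positivity
  rw [he]
  have hm2 : Measurable fun x => fracLap s f (c⁻¹ • x) := hm.comp (measurable_const_smul _)
  have hm3 : Measurable fun x => fracLap s f (c⁻¹ • (x - x₀)) :=
    hm2.comp (measurable_id.sub_const x₀)
  refine ⟨hm3.const_mul _, ?_, fun x => ?_⟩
  · simp_rw [enorm_mul]
    rw [lintegral_const_mul _ hm3.enorm,
      lintegral_sub_right_eq_self (fun x => ‖fracLap s f (c⁻¹ • x)‖ₑ) x₀,
      lintegral_dil (fun x => ‖fracLap s f x‖ₑ) hm.enorm _ (inv_pos.2 hc),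
      ENNReal.ofReal_mul hcs.le, ENNReal.ofReal_mul (by positivity), ← ofReal_norm,
      Real.norm_of_nonneg hcs.le, inv_pow, inv_inv]
    gcongr
  · rw [abs_mul, abs_of_pos hcs]
    gcongr
    exact hM _

end FL10

/-- `Δ^{s/2}` of a Schwartz function lies in all Lorentz spaces, and the
scaling estimate for the dyadic cutoff family. -/
theorem statement_10 (n : ℕ) (hn : 1 ≤ n) (s : ℝ) (hs : 0 ≤ s) (p q : ℝ≥0∞)
    (hpq : (1 < p ∧ p < ⊤ ∧ 1 ≤ q) ∨ (p = 1 ∧ q = 1) ∨ (p = ⊤ ∧ q = ⊤)) :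
    (∀ f : SchwartzMap (Eucl n) ℝ, lorentzNorm p q (fracLap s ⇑f) < ⊤) ∧
    (∀ η₀ : Eucl n → ℝ, ContDiff ℝ (⊤ : ℕ∞) η₀ → HasCompactSupport η₀ →
      ∃ C > (0:ℝ), ∀ (x₀ : Eucl n) (r : ℝ), 0 < r → ∀ k : ℕ,
        lorentzNorm p q (fracLap s (fun x => η₀ (((2:ℝ) ^ k * r)⁻¹ • (x - x₀)))) ≤
          ENNReal.ofReal (C * ((2:ℝ) ^ k * r) ^ ((n:ℝ) * (1 / p).toReal - s))) := by
  obtain ⟨C, hC, hL⟩ := FL10.lorentz_bound (n := n) p q hpq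
  refine ⟨fun f => ?_, fun η₀ h1 h2 => ?_⟩
  · obtain ⟨hm, A, hA, M, hM, hb1, hb2⟩ := FL10.fracLap_bounds s hs f
    exact lt_of_le_of_lt (hL _ hm A hA M hM hb1 hb2) ENNReal.ofReal_lt_top
  · obtain ⟨hm, A, hA, M, hM, hb1, hb2⟩ :=
      FL10.fracLap_bounds s hs (HasCompactSupport.toSchwartzMap h2 h1)
    set θ := (1 / p).toReal with hθ
    refine ⟨C * (A ^ θ * M ^ (1 - θ)), by positivity, fun x₀ r hr k => ?_⟩
    have hc : 0 < (2 : ℝ) ^ k * r := by positivity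
    set c := (2 : ℝ) ^ k * r
    obtain ⟨k1, k2, k3⟩ := FL10.scaled_bound s η₀ hm A M hb1 hb2 c hc x₀
    refine (hL _ k1 _ (by positivity) _ (by positivity) k2 k3).trans ?_
    apply ENNReal.ofReal_le_ofReal
    apply le_of_eq
    have e1 : (c ^ (-s) * (c ^ n * A)) ^ θ = c ^ (-s * θ + n * θ) * A ^ θ := by
      rw [← mul_assoc, Real.mul_rpow (by positivity) hA.le, ← Real.rpow_natCast,
        ← Real.rpow_add hc, ← Real.rpow_mul hc.le, add_mul]
    have e2 : (c ^ (-s) * M) ^ (1 - θ) = c ^ (-s * (1 - θ)) * M ^ (1 - θ) := by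
      rw [Real.mul_rpow (by positivity) hM.le, ← Real.rpow_mul hc.le]
    have e3 : c ^ ((n : ℝ) * θ - s) = c ^ (-s * θ + n * θ) * c ^ (-s * (1 - θ)) := by
      rw [← Real.rpow_add hc]
      congr 1
      ring
    rw [e1, e2, e3]
    ring
end
end
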